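/- For every integer n ≥ 6, the maximal number of alternating monomials in commutator monomials satisfies the exact scaling relation r_{n+4} = 6 · r_n. -/

import Mathlib

open scoped Classical

/-- Full plane binary trees with leaves labeled by natural numbers
(representing the variables `X_i`). -/
inductive BTree : Type where
  | leaf : ℕ → BTree
  | node : BTree → BTree → BTree

namespace BTree

/-- The list of leaf labels, from left to right. -/
def leaves : BTree → List ℕ
  | leaf a => [a]
  | node l r => l.leaves ++ r.leaves

/-- The expansion set `W(T, ℓ)` of the commutator monomial modeled by `T`. -/
def words : BTree → Finset (List ℕ)
  | leaf a => {[a]}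
  | node l r =>
      ((l.words ×ˢ r.words).image fun p => p.1 ++ p.2) ∪
      ((l.words ×ˢ r.words).image fun p => p.2 ++ p.1)

end BTree

/-- A word (list of labels) is alternating: consecutive entries differ, and no entry
lies strictly between its two neighbours. -/
def IsAlternating (w : List ℕ) : Prop :=
  (∀ i, i + 1 < w.length → w.getD i 0 ≠ w.getD (i + 1) 0) ∧
  (∀ i, i + 2 < w.length →
    ¬ (w.getD i 0 < w.getD (i + 1) 0 ∧ w.getD (i + 1) 0 < w.getD (i + 2) 0) ∧
    ¬ (w.getD (i + 2) 0 < w.getD (i + 1) 0 ∧ w.getD (i + 1) 0 < w.getD i 0))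

/-- A word is forward alternating: alternating, and it does not start with an ascent. -/
def IsForwardAlternating (w : List ℕ) : Prop :=
  IsAlternating w ∧ (w.length ≤ 1 ∨ w.getD 1 0 < w.getD 0 0)

/-- Number of alternating words in the expansion of `t`. -/
noncomputable def altCount (t : BTree) : ℕ :=
  (t.words.filter fun w => IsAlternating w).card

/-- Number of forward alternating words in the expansion of `t`. -/
noncomputable def faltCount (t : BTree) : ℕ :=
  (t.words.filter fun w => IsForwardAlternating w).card

/-- `rAlt n` : the maximal number of alternating associative monomials in a commutator
monomial whose leaves are labeled bijectively by `{1, …, n}`. -/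
noncomputable def rAlt (n : ℕ) : ℕ :=
  sSup {m | ∃ t : BTree, t.leaves.Perm (List.range' 1 n) ∧ m = altCount t}

/-- `rFAlt n` : the forward-alternating analogue of `rAlt n`. -/
noncomputable def rFAlt (n : ℕ) : ℕ :=
  sSup {m | ∃ t : BTree, t.leaves.Perm (List.range' 1 n) ∧ m = faltCount t}

/-- The number of alternating permutations of `{1, …, n}` (denoted `Ẽ_n`). -/
noncomputable def altPerms (n : ℕ) : ℕ :=
  Nat.card {σ : Equiv.Perm (Fin n) // IsAlternating (List.ofFn fun i => (σ i : ℕ))}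

/-- The number of forward alternating permutations of `{1, …, n}` (denoted `E_n`). -/
noncomputable def faltPerms (n : ℕ) : ℕ :=
  Nat.card {σ : Equiv.Perm (Fin n) // IsForwardAlternating (List.ofFn fun i => (σ i : ℕ))}

namespace BTree

/-- An end of a word: whether the letter there is a peak, and its value. -/
abbrev WordEnd := Bool × ℕ

/-- A weighted list of words, of which only the two ends are recorded. -/
abbrev Profile := List (ℕ × WordEnd × WordEnd)

/-- Whether `e` may be followed by `f`: one is a peak, the other a smaller valley. -/
def joins (e f : WordEnd) : Bool :=
  bif e.1 then !f.1 && Nat.blt f.2 e.2 else f.1 && Nat.blt e.2 f.2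

/-- All junctions of a word of `μ` with a word of `ν`, in both orders. -/
def prod (μ ν : Profile) : Profile :=
  μ.flatMap fun x => ν.flatMap fun y =>
    (bif joins x.2.2 y.2.1 then [(x.1 * y.1, x.2.1, y.2.2)] else []) ++
    (bif joins y.2.2 x.2.1 then [(x.1 * y.1, y.2.1, x.2.2)] else [])

/-- The weighted sum of `Φ` over a profile. -/
def total (Φ : WordEnd → WordEnd → ℕ) (μ : Profile) : ℕ :=
  (μ.map fun x => x.1 * Φ x.2.1 x.2.2).sum

/-- Extension of the increasing sequence `A` by `0` on the left and by `N` on the right. -/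
def val (N : ℕ) (A : List ℕ) (i : ℕ) : ℕ := (0 :: A).getD i N

/-- Change the values of the ends of a profile. -/
def relabel (σ : ℕ → ℕ) (μ : Profile) : Profile :=
  μ.map fun x => (x.1, (x.2.1.1, σ x.2.1.2), (x.2.2.1, σ x.2.2.2))

/-- Multiply all weights by `c`. -/
def scale (c : ℕ) (μ : Profile) : Profile := μ.map fun x => (c * x.1, x.2)

/-- Position of an end among the ends of the same kind with values in `{0, …, T}`. -/
def rank (T : ℕ) (e : WordEnd) : ℕ := bif e.1 then e.2 else T - e.2

/-- The weights and ranks of the words of `μ` whose ends have the kinds `t` and `t'`. -/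
def ranks (T : ℕ) (t t' : Bool) (μ : Profile) : List (ℕ × ℕ × ℕ) :=
  μ.foldr (fun x acc =>
    bif (bif t then x.2.1.1 else !x.2.1.1) && (bif t' then x.2.2.1 else !x.2.2.1) then
      (x.1, rank T x.2.1, rank T x.2.2) :: acc
    else acc) []

/-- The words whose first end has rank more than `r`. -/
def firstUpper (r : ℕ) (l : List (ℕ × ℕ × ℕ)) : List (ℕ × ℕ) :=
  l.foldr (fun x acc => bif Nat.blt r x.2.1 then (x.1, x.2.2) :: acc else acc) []

/-- The weight of the words whose last end has rank more than `r`. -/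
def lastUpper (r : ℕ) (l : List (ℕ × ℕ)) : ℕ :=
  l.foldr (fun x acc => bif Nat.blt r x.2 then x.1 + acc else acc) 0

/-- Whether all values in `μ` are at most `T`. -/
def boundedBy (T : ℕ) (μ : Profile) : Bool :=
  μ.all fun x => Nat.ble x.2.1.2 T && Nat.ble x.2.2.2 T

/-- Whether all ranks in `μ` are positive. -/
def ranksPos (T : ℕ) (μ : Profile) : Bool :=
  μ.all fun x => Nat.blt 0 (rank T x.2.1) && Nat.blt 0 (rank T x.2.2)

/-- Comparison of two lists of weights and ranks on all pairs of upper sets. -/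
def ranksLe (T : ℕ) (a b : List (ℕ × ℕ × ℕ)) : Bool :=
  (List.range T).all fun r => (List.range T).all fun r' =>
    Nat.ble (lastUpper r' (firstUpper r a)) (lastUpper r' (firstUpper r b))

/-- Comparison of two profiles on all pairs of upper sets. -/
def dominates (T : ℕ) (μ ν : Profile) : Bool :=
  boundedBy T μ && boundedBy T ν && ranksPos T μ &&
  [true, false].all fun t => [true, false].all fun t' =>
    (ranks T t t' μ).isEmpty || ranksLe T (ranks T t t' μ) (ranks T t t' ν)

/-- Whether two ends are equal. -/
def sameEnd (e f : WordEnd) : Bool := Nat.beq e.2 f.2 && (bif e.1 then f.1 else !f.1)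

/-- Add a word to a profile, joining it with an equal one if there is one. -/
def insertWord (x : ℕ × WordEnd × WordEnd) : Profile → Profile
  | [] => [x]
  | y :: μ => bif sameEnd x.2.1 y.2.1 && sameEnd x.2.2 y.2.2 then (x.1 + y.1, y.2) :: μ
      else y :: insertWord x μ

/-- Join equal words of a profile. -/
def compress (μ : Profile) : Profile := μ.foldr insertWord []

/-- The index in `K` which an end is moved to when only the letters in `K` are kept. -/
def keepIndex (K : List ℕ) (e : WordEnd) : ℕ :=
  bif e.1 then (K.countP fun x => Nat.blt x e.2) + 1 else K.countP fun x => Nat.ble x e.2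

/-- Enlarge the ends of a profile so that only the letters in `K` are used. -/
def coarsen (K : List ℕ) (μ : Profile) : Profile :=
  μ.map fun x => (x.1, (x.2.1.1, keepIndex K x.2.1), (x.2.2.1, keepIndex K x.2.2))

/-- Whether `keepIndex` does enlarge the end `e`, for profiles with `k` letters. -/
def enlarges (k : ℕ) (K : List ℕ) (e : WordEnd) : Bool :=
  bif e.1 then Nat.ble e.2 (val (k + 1) K (keepIndex K e))
  else Nat.ble (val (k + 1) K (keepIndex K e)) e.2

/-- The sequences of length `n` with exactly `k` terms `true`. -/
def shuffles : ℕ → ℕ → List (List Bool)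
  | 0, 0 => [[]]
  | 0, _ + 1 => []
  | n + 1, 0 => (shuffles n 0).map (false :: ·)
  | n + 1, k + 1 => (shuffles n k).map (true :: ·) ++ (shuffles n (k + 1)).map (false :: ·)

/-- The entries of a list at the places where `w` is `b`. -/
def select (b : Bool) : List Bool → List ℕ → List ℕ
  | c :: w, x :: l => bif b == c then x :: select b w l else select b w l
  | _, _ => []

/-- Whether a list is weakly increasing. -/
def isSorted : List ℕ → Bool
  | a :: b :: l => Nat.ble a b && isSorted (b :: l)
  | _ => true

/-- A profile with `letters` letters, for trees whose number of leaves is `cls` modulo `4`. -/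
structure Model where
  cls : ℕ
  letters : ℕ
  words : Profile

/-- A way to bound a product of two models: the letters to be kept in both, and for each
interleaving a mixture of relabeled models. -/
structure Bound where
  left : List ℕ
  right : List ℕ
  mixtures : List (List (ℕ × ℕ × List ℕ))

/-- A peak. -/
abbrev p (i : ℕ) : WordEnd := (true, i)

/-- A valley. -/
abbrev v (i : ℕ) : WordEnd := (false, i)

/-- The models. -/
def models : List Model := [
  ⟨1, 1, [(36, p 1, p 1), (36, v 1, v 1)]⟩,
  ⟨2, 0, [(36, p 1, v 0), (36, v 0, p 1)]⟩,
  ⟨3, 1, [(36, p 1, p 2), (36, p 2, p 1), (36, v 0, v 1), (36, v 1, v 0)]⟩,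
  ⟨4, 2, [(36, p 3, v 1), (36, v 1, p 3), (36, p 1, v 2), (36, v 2, p 1), (36, p 2, v 1),
    (36, v 1, p 2)]⟩,
  ⟨4, 2, [(36, p 1, v 2), (36, v 2, p 1), (36, p 2, v 0), (36, v 0, p 2), (36, p 2, v 1),
    (36, v 1, p 2)]⟩,
  ⟨1, 1, [(12, p 2, p 2), (6, p 1, p 2), (6, p 2, p 1), (12, v 0, v 0), (6, v 0, v 1),
    (6, v 1, v 0)]⟩,
  ⟨2, 2, [(18, p 3, v 1), (18, v 1, p 3), (12, p 1, v 0), (12, v 0, p 1), (6, p 1, v 2),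
    (6, v 2, p 1), (6, p 2, v 1), (6, v 1, p 2)]⟩,
  ⟨2, 2, [(12, p 3, v 2), (12, v 2, p 3), (6, p 1, v 2), (6, v 2, p 1), (18, p 2, v 0),
    (18, v 0, p 2), (6, p 2, v 1), (6, v 1, p 2)]⟩,
  ⟨2, 2, [(6, p 3, v 0), (6, v 0, p 3), (6, p 3, v 1), (6, v 1, p 3), (6, p 3, v 2),
    (6, v 2, p 3), (6, p 1, v 0), (6, v 0, p 1), (6, p 1, v 2), (6, v 2, p 1), (6, p 2, v 0),
    (6, v 0, p 2), (6, p 2, v 1), (6, v 1, p 2)]⟩,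
  ⟨3, 3, [(6, p 1, p 4), (6, p 4, p 1), (6, p 1, p 2), (6, p 2, p 1), (6, p 1, p 3),
    (6, p 3, p 1), (18, v 0, v 1), (18, v 1, v 0), (12, v 1, v 2), (12, v 2, v 1),
    (12, v 1, v 3), (12, v 3, v 1)]⟩,
  ⟨3, 3, [(12, p 1, p 3), (12, p 3, p 1), (12, p 2, p 3), (12, p 3, p 2), (18, p 3, p 4),
    (18, p 4, p 3), (6, v 0, v 3), (6, v 3, v 0), (6, v 1, v 3), (6, v 3, v 1), (6, v 2, v 3),
    (6, v 3, v 2)]⟩,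
  ⟨3, 3, [(18, p 1, p 3), (18, p 3, p 1), (6, p 2, p 3), (6, p 3, p 2), (18, p 3, p 4),
    (18, p 4, p 3), (18, v 1, v 3), (18, v 3, v 1)]⟩,
  ⟨3, 3, [(18, p 1, p 3), (18, p 3, p 1), (18, v 0, v 1), (18, v 1, v 0), (6, v 1, v 2),
    (6, v 2, v 1), (18, v 1, v 3), (18, v 3, v 1)]⟩,
  ⟨4, 2, [(6, p 1, v 2), (6, v 2, p 1), (18, p 2, v 0), (18, v 0, p 2), (66, p 2, v 1),
    (66, v 1, p 2)]⟩,
  ⟨4, 2, [(18, p 3, v 1), (18, v 1, p 3), (6, p 1, v 2), (6, v 2, p 1), (66, p 2, v 1),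
    (66, v 1, p 2)]⟩,
  ⟨1, 1, [(14, p 1, p 2), (14, p 2, p 1), (14, v 0, v 1), (14, v 1, v 0)]⟩,
  ⟨2, 2, [(14, p 3, v 1), (14, v 1, p 3), (14, p 1, v 2), (14, v 2, p 1), (14, p 2, v 1),
    (14, v 1, p 2)]⟩,
  ⟨2, 2, [(14, p 1, v 2), (14, v 2, p 1), (14, p 2, v 0), (14, v 0, p 2), (14, p 2, v 1),
    (14, v 1, p 2)]⟩,
  ⟨3, 3, [(1, p 1, p 2), (1, p 2, p 1), (14, p 2, p 3), (14, p 3, p 2), (14, p 3, p 4),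
    (14, p 4, p 3), (6, v 0, v 0), (11, v 0, v 1), (11, v 1, v 0), (3, v 0, v 2), (3, v 2, v 0),
    (11, v 1, v 2), (11, v 2, v 1), (1, v 2, v 3), (1, v 3, v 2)]⟩,
  ⟨3, 3, [(6, p 4, p 4), (1, p 1, p 2), (1, p 2, p 1), (3, p 2, p 4), (3, p 4, p 2),
    (11, p 2, p 3), (11, p 3, p 2), (11, p 3, p 4), (11, p 4, p 3), (14, v 0, v 1),
    (14, v 1, v 0), (14, v 1, v 2), (14, v 2, v 1), (1, v 2, v 3), (1, v 3, v 2)]⟩]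

/-- The bounds of the product of the models `i` and `i + d`, in row `i` and place `d`. -/
def bounds : List (List Bound) := [
  [⟨[1], [1], [[(1, 1, [])], [(1, 1, [])]]⟩,
   ⟨[1], [], [[(1, 2, [1])]]⟩,
   ⟨[1], [1], [[(1, 3, [1, 2])], [(1, 4, [1, 2])]]⟩,
   ⟨[1], [1, 2], [[(1, 0, [0])], [(1, 5, [2])], [(1, 0, [1]), (4, 0, [4]), (1, 0, [3])]]⟩,
   ⟨[1], [1, 2], [[(4, 0, [0]), (1, 0, [1]), (1, 0, [3])], [(1, 5, [2])], [(1, 0, [3])]]⟩,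
   ⟨[1], [1], [[(1, 6, [1, 2])], [(1, 7, [1, 2])]]⟩,
   ⟨[1], [1, 2], [[(1, 9, [1, 1, 2])], [(1, 2, [2])], [(1, 11, [1, 3, 3])]]⟩,
   ⟨[1], [1, 2], [[(1, 12, [1, 1, 3])], [(1, 2, [2])], [(1, 10, [2, 2, 3])]]⟩,
   ⟨[1], [1, 2], [[(1, 9, [1, 2, 3])], [(1, 2, [2])], [(1, 10, [1, 2, 3])]]⟩,
   ⟨[1], [1, 3], [[(1, 3, [0, 1])], [(1, 4, [1, 2])], [(1, 13, [1, 3])]]⟩,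
   ⟨[1], [1, 3], [[(1, 14, [1, 3])], [(1, 3, [2, 3])], [(1, 3, [0, 2])]]⟩,
   ⟨[1], [1], [[(1, 13, [0, 3])], [(2, 3, [1, 2]), (1, 13, [2, 3]), (1, 3, [2, 2])]]⟩,
   ⟨[1], [3], [[(1, 14, [0, 2]), (2, 4, [1, 1]), (1, 4, [1, 2])], [(1, 13, [0, 3])]]⟩,
   ⟨[1], [1, 2], [[(1, 0, [0]), (1, 5, [0])], [(1, 15, [2])], [(1, 0, [3])]]⟩,
   ⟨[1], [1, 2], [[(1, 0, [0])], [(1, 15, [2])], [(1, 0, [3]), (1, 5, [2])]]⟩,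
   ⟨[1], [1], [[(1, 16, [1, 2])], [(1, 17, [1, 2])]]⟩,
   ⟨[1], [1, 2], [[(1, 9, [0, 0, 0])], [(1, 2, [2])], [(2, 10, [1, 2, 3]), (1, 11, [1, 3, 3])]]⟩,
   ⟨[1], [1, 2], [[(1, 9, [1, 1, 1]), (2, 12, [1, 1, 3])], [(1, 2, [2])], [(1, 10, [1, 2, 3])]]⟩,
   ⟨[1], [2], [[(1, 3, [1, 2]), (1, 13, [0, 3]), (1, 3, [1, 1])], [(1, 13, [0, 3]),
     (1, 4, [2, 2]), (1, 4, [1, 2])]]⟩,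
   ⟨[1], [2], [[(1, 3, [1, 2]), (1, 13, [0, 3]), (1, 3, [1, 1])], [(1, 13, [0, 3]),
     (1, 4, [2, 2]), (1, 4, [1, 2])]]⟩],
  [⟨[], [], [[(1, 3, [0, 1])]]⟩,
   ⟨[], [1], [[(1, 5, [1])]]⟩,
   ⟨[], [], [[(1, 1, [])]]⟩,
   ⟨[], [], [[(1, 1, [])]]⟩,
   ⟨[], [1], [[(2, 10, [2, 2, 2]), (2, 9, [0, 0, 0]), (3, 18, [0, 1, 2])]]⟩,
   ⟨[], [], [[(1, 13, [0, 1])]]⟩,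
   ⟨[], [], [[(1, 13, [0, 1])]]⟩,
   ⟨[], [], [[(1, 13, [0, 1])]]⟩,
   ⟨[], [1], [[(1, 0, [0]), (1, 5, [1])]]⟩,
   ⟨[], [1], [[(1, 0, [2]), (1, 5, [1])]]⟩,
   ⟨[], [1], [[(1, 0, [2]), (1, 5, [1])]]⟩,
   ⟨[], [1], [[(1, 0, [0]), (1, 5, [1])]]⟩,
   ⟨[], [], [[(1, 1, [])]]⟩,
   ⟨[], [], [[(1, 1, [])]]⟩,
   ⟨[], [1], [[(1, 18, [0, 1, 2])]]⟩,
   ⟨[], [], [[(1, 13, [0, 1])]]⟩,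
   ⟨[], [], [[(1, 13, [0, 1])]]⟩,
   ⟨[], [2], [[(1, 0, [0]), (3, 5, [1]), (2, 5, [2])]]⟩,
   ⟨[], [2], [[(1, 0, [0]), (3, 5, [1]), (2, 5, [2])]]⟩],
  [⟨[1], [1], [[(1, 8, [1, 2])], [(1, 8, [1, 2])]]⟩,
   ⟨[1], [1, 2], [[(1, 2, [1])], [(1, 2, [3]), (3, 18, [1, 2, 4]), (1, 2, [1])], [(1, 2, [3]),
     (1, 10, [4, 4, 4]), (1, 2, [1])]]⟩,
   ⟨[1], [1, 2], [[(1, 2, [1]), (1, 2, [3]), (1, 9, [0, 0, 0])], [(1, 2, [1]),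
     (3, 19, [0, 2, 3]), (1, 2, [3])], [(1, 2, [2])]]⟩,
   ⟨[1], [1], [[(1, 3, [1, 1]), (2, 13, [0, 3])], [(1, 3, [1, 2]), (2, 13, [0, 3])]]⟩,
   ⟨[1], [1], [[(1, 0, [0]), (2, 15, [2])], [(1, 0, [1]), (1, 0, [3]), (3, 15, [2]),
     (2, 5, [1])]]⟩,
   ⟨[1], [2], [[(1, 0, [0]), (2, 15, [1]), (2, 15, [2]), (1, 5, [1])], [(1, 0, [2]),
     (2, 5, [1])]]⟩,
   ⟨[1], [1, 2], [[(1, 0, [0]), (1, 0, [1]), (1, 15, [3]), (1, 5, [2])], [(1, 5, [2])],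
     [(1, 0, [4]), (1, 5, [2]), (1, 0, [3]), (1, 15, [1])]]⟩,
   ⟨[1], [1], [[(1, 1, [])], [(1, 1, []), (1, 8, [1, 2])]]⟩,
   ⟨[1], [1], [[(1, 1, [])], [(2, 1, []), (1, 7, [1, 2])]]⟩,
   ⟨[1], [1], [[(1, 1, [])], [(1, 1, []), (1, 8, [1, 2])]]⟩,
   ⟨[1], [1], [[(1, 1, [])], [(1, 1, []), (1, 8, [1, 2])]]⟩,
   ⟨[1], [1, 2], [[(1, 2, [1]), (1, 18, [0, 0, 4])], [(1, 18, [1, 2, 3])], [(1, 2, [2])]]⟩,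
   ⟨[1], [1, 2], [[(1, 2, [1])], [(1, 19, [1, 2, 3])], [(1, 2, [2]), (1, 18, [0, 2, 4])]]⟩,
   ⟨[1], [1], [[(3, 3, [1, 2]), (4, 13, [0, 3]), (1, 4, [1, 1]), (2, 4, [2, 2])],
     [(3, 3, [1, 2]), (4, 13, [0, 3]), (1, 4, [1, 1]), (2, 4, [2, 2])]]⟩,
   ⟨[1], [1], [[(1, 15, [1])], [(1, 0, [1]), (2, 0, [3]), (4, 15, [2]), (6, 5, [1]),
     (1, 0, [2])]]⟩,
   ⟨[1], [1], [[(1, 0, [1]), (2, 5, [1])], [(1, 0, [1]), (2, 0, [3]), (4, 15, [2]), (6, 5, [1]),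
     (1, 0, [2])]]⟩,
   ⟨[1], [1], [[(1, 1, [])], [(14, 8, [2, 2]), (1, 8, [1, 2]), (21, 1, [])]]⟩,
   ⟨[1], [1], [[(1, 1, [])], [(21, 1, []), (14, 8, [2, 2]), (1, 8, [1, 2])]]⟩],
  [⟨[1], [1], [[(1, 3, [1, 2]), (1, 13, [0, 3])], [(1, 3, [1, 2]), (1, 13, [0, 3])]]⟩,
   ⟨[1], [1, 2], [[(1, 3, [1, 3]), (1, 13, [0, 4])], [(1, 13, [0, 4])], [(1, 3, [0, 1])]]⟩,
   ⟨[1, 2], [], [[(1, 5, [1]), (1, 5, [2])]]⟩,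
   ⟨[1], [1], [[(1, 1, []), (1, 6, [1, 2])], [(1, 1, [])]]⟩,
   ⟨[1], [2], [[(1, 1, []), (1, 7, [1, 2])], [(1, 1, [])]]⟩,
   ⟨[1], [1], [[(1, 1, []), (1, 8, [1, 2])], [(1, 1, [])]]⟩,
   ⟨[1], [1], [[(1, 2, [1]), (1, 18, [0, 2, 3])], [(1, 9, [1, 1, 2])]]⟩,
   ⟨[1, 2], [1], [[(3, 10, [4, 4, 4]), (1, 10, [2, 3, 3]), (7, 10, [2, 4, 4]),
     (4, 10, [1, 2, 3]), (3, 10, [1, 1, 1])], [(2, 10, [4, 4, 4]), (1, 10, [3, 3, 3]),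
     (1, 10, [3, 3, 4]), (2, 2, [1])], [(1, 2, [2]), (1, 10, [3, 4, 4])]]⟩,
   ⟨[1, 2], [1], [[(1, 10, [1, 1, 3]), (1, 10, [4, 4, 4])], [(1, 2, [1]), (2, 10, [3, 3, 4])],
     [(1, 2, [2]), (1, 2, [4])]]⟩,
   ⟨[1], [1], [[(1, 2, [1]), (1, 18, [0, 2, 3])], [(1, 9, [1, 1, 2])]]⟩,
   ⟨[1, 2], [], [[(1, 3, [1, 2]), (2, 13, [0, 3])]]⟩,
   ⟨[1, 2], [], [[(1, 3, [1, 2]), (2, 13, [0, 3])]]⟩,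
   ⟨[1], [1], [[(1, 0, [1]), (2, 0, [3]), (4, 15, [2]), (6, 5, [1]), (1, 0, [2])],
     [(1, 15, [1])]]⟩,
   ⟨[1], [1], [[(1, 1, [])], [(1, 1, [])]]⟩,
   ⟨[1], [1], [[(1, 1, []), (1, 8, [1, 2])], [(1, 1, [])]]⟩,
   ⟨[1, 2], [], [[(1, 2, [1]), (3, 18, [0, 2, 3])]]⟩,
   ⟨[1, 2], [], [[(1, 2, [1]), (3, 18, [0, 2, 3])]]⟩],
  [⟨[2], [2], [[(1, 4, [1, 1]), (1, 13, [0, 3])], [(1, 4, [1, 1]), (1, 13, [0, 3])]]⟩,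
   ⟨[1, 2], [], [[(1, 5, [1]), (1, 5, [2])]]⟩,
   ⟨[1], [1], [[(1, 1, []), (1, 6, [1, 2])], [(1, 1, [])]]⟩,
   ⟨[1], [2], [[(1, 1, []), (1, 7, [1, 2])], [(1, 1, [])]]⟩,
   ⟨[1], [1], [[(1, 1, []), (1, 8, [1, 2])], [(1, 1, []), (1, 8, [1, 2])]]⟩,
   ⟨[1, 2], [3], [[(1, 2, [2]), (1, 9, [0, 0, 0])], [(3, 9, [0, 0, 0]), (1, 9, [1, 1, 1]),
     (2, 2, [3])], [(3, 9, [2, 2, 2]), (3, 9, [3, 3, 3]), (2, 9, [1, 3, 3]),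
     (10, 9, [0, 0, 0])]]⟩,
   ⟨[2], [3], [[(1, 10, [1, 1, 2])], [(1, 2, [1]), (1, 18, [0, 1, 3])]]⟩,
   ⟨[2], [3], [[(1, 10, [1, 1, 2])], [(1, 2, [1]), (1, 18, [0, 1, 3])]]⟩,
   ⟨[1, 2], [3], [[(1, 2, [0]), (1, 2, [2])], [(1, 2, [2]), (2, 9, [0, 0, 0])],
     [(1, 9, [0, 0, 0]), (1, 9, [1, 1, 3])]]⟩,
   ⟨[1, 2], [], [[(1, 4, [1, 2]), (2, 13, [0, 3])]]⟩,
   ⟨[1, 2], [], [[(1, 4, [1, 2]), (2, 13, [0, 3])]]⟩,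
   ⟨[1], [1], [[(1, 0, [1]), (2, 0, [3]), (4, 15, [2]), (6, 5, [1]), (1, 0, [2])], [(1, 0, [1]),
     (2, 5, [1])]]⟩,
   ⟨[1], [1], [[(1, 1, [])], [(1, 1, []), (1, 8, [1, 2])]]⟩,
   ⟨[1], [1], [[(1, 1, []), (1, 8, [1, 2])], [(1, 1, []), (1, 8, [1, 2])]]⟩,
   ⟨[1, 2], [], [[(1, 2, [1]), (3, 18, [0, 2, 3])]]⟩,
   ⟨[1, 2], [], [[(1, 2, [1]), (3, 18, [0, 2, 3])]]⟩],
  [⟨[], [], [[(1, 1, [])]]⟩,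
   ⟨[], [1, 2], [[(3, 18, [0, 1, 3]), (1, 18, [0, 2, 3])]]⟩,
   ⟨[], [1, 2], [[(1, 18, [0, 1, 3]), (3, 18, [0, 2, 3])]]⟩,
   ⟨[], [1, 2], [[(1, 18, [0, 1, 3]), (1, 18, [0, 2, 3])]]⟩,
   ⟨[], [], [[(1, 13, [0, 1])]]⟩,
   ⟨[], [], [[(1, 13, [0, 1])]]⟩,
   ⟨[], [], [[(1, 13, [0, 1])]]⟩,
   ⟨[], [], [[(1, 13, [0, 1])]]⟩,
   ⟨[1], [], [[(1, 0, [0]), (2, 5, [1]), (3, 5, [2])]]⟩,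
   ⟨[1], [], [[(1, 0, [0]), (2, 5, [1]), (3, 5, [2])]]⟩,
   ⟨[], [1], [[(2, 1, []), (1, 8, [1, 1])]]⟩,
   ⟨[], [1, 2], [[(1, 18, [0, 1, 3]), (1, 18, [0, 2, 3])]]⟩,
   ⟨[], [1, 2], [[(1, 18, [0, 1, 3]), (1, 18, [0, 2, 3])]]⟩,
   ⟨[], [], [[(1, 13, [0, 1])]]⟩,
   ⟨[], [], [[(1, 13, [0, 1])]]⟩],
  [⟨[1], [1], [[(1, 13, [0, 3])], [(1, 13, [0, 3])]]⟩,
   ⟨[1], [1], [[(1, 3, [1, 1]), (2, 13, [0, 3])], [(154, 3, [1, 2]), (108, 13, [1, 3]),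
     (285, 13, [0, 3]), (102, 13, [2, 3]), (143, 3, [2, 2])]]⟩,
   ⟨[1], [1], [[(1, 3, [0, 3]), (1, 3, [1, 2])], [(1, 3, [1, 2]), (1, 13, [0, 3])]]⟩,
   ⟨[1], [1], [[(1, 5, [1])], [(2, 0, [0]), (1, 15, [2])]]⟩,
   ⟨[1], [1], [[(2, 0, [3]), (1, 15, [1])], [(1, 0, [3]), (1, 15, [2]), (1, 5, [1])]]⟩,
   ⟨[1], [1], [[(2, 0, [3]), (1, 15, [1])], [(1, 0, [3]), (2, 5, [2])]]⟩,
   ⟨[1], [1], [[(1, 5, [1])], [(2, 0, [0]), (1, 15, [2])]]⟩,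
   ⟨[], [], [[(1, 1, [])]]⟩,
   ⟨[], [], [[(1, 1, [])]]⟩,
   ⟨[1], [1], [[(2, 2, [1]), (1, 10, [3, 3, 3]), (1, 2, [2])], [(1, 9, [1, 1, 1]),
     (1, 18, [0, 2, 3])]]⟩,
   ⟨[1], [1], [[(1, 13, [0, 3])], [(1, 3, [0, 3]), (1, 3, [1, 2])]]⟩,
   ⟨[1], [1], [[(1, 13, [0, 3])], [(1, 3, [0, 3]), (1, 3, [1, 2])]]⟩,
   ⟨[1], [], [[(8, 5, [1]), (1, 5, [2])]]⟩,
   ⟨[1], [], [[(8, 5, [1]), (1, 5, [2])]]⟩],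
  [⟨[2], [2], [[(1, 13, [0, 3])], [(1, 13, [0, 3])]]⟩,
   ⟨[2], [1], [[(1, 13, [0, 3])], [(1, 3, [1, 2]), (2, 13, [0, 3])]]⟩,
   ⟨[2], [1], [[(1, 5, [1])], [(3, 0, [0]), (2, 15, [2])]]⟩,
   ⟨[2], [2], [[(2, 0, [3]), (1, 15, [1])], [(2, 0, [3]), (3, 5, [1])]]⟩,
   ⟨[2], [1], [[(1, 0, [1]), (2, 0, [3])], [(3, 0, [3]), (2, 15, [1]), (1, 15, [2])]]⟩,
   ⟨[2], [1], [[(1, 5, [1])], [(3, 0, [0]), (2, 15, [2])]]⟩,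
   ⟨[], [], [[(1, 1, [])]]⟩,
   ⟨[], [], [[(1, 1, [])]]⟩,
   ⟨[2], [1], [[(1, 10, [1, 1, 2]), (1, 18, [0, 1, 3])], [(2, 2, [2]), (1, 2, [1]),
     (1, 9, [0, 0, 0])]]⟩,
   ⟨[1], [1], [[(7, 3, [2, 2]), (17, 13, [0, 3])], [(1, 3, [1, 2]), (2, 13, [0, 3])]]⟩,
   ⟨[2], [1], [[(1, 13, [0, 3])], [(1, 4, [1, 2]), (1, 13, [0, 3])]]⟩,
   ⟨[2], [], [[(1, 5, [0]), (8, 5, [1])]]⟩,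
   ⟨[2], [], [[(1, 5, [0]), (8, 5, [1])]]⟩],
  [⟨[1], [1], [[(1, 3, [1, 2]), (2, 13, [0, 3])], [(1, 3, [1, 2]), (2, 13, [0, 3])]]⟩,
   ⟨[1], [1], [[(1, 0, [1]), (1, 5, [2])], [(3, 0, [0]), (1, 0, [1]), (1, 15, [2]),
     (1, 5, [1])]]⟩,
   ⟨[1], [1], [[(1, 0, [1]), (5, 0, [3]), (1, 15, [2]), (1, 5, [1])], [(3, 0, [3]),
     (2, 15, [2]), (2, 5, [1])]]⟩,
   ⟨[1], [1], [[(3, 0, [3]), (2, 15, [2])], [(2, 0, [3]), (3, 5, [2])]]⟩,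
   ⟨[1], [1], [[(1, 0, [1]), (1, 5, [2])], [(3, 0, [0]), (1, 0, [1]), (1, 15, [2]),
     (1, 5, [1])]]⟩,
   ⟨[], [], [[(1, 1, [])]]⟩,
   ⟨[], [], [[(1, 1, [])]]⟩,
   ⟨[1], [1], [[(9, 2, [1]), (5, 2, [2]), (7, 18, [2, 2, 3]), (11, 18, [0, 2, 3]),
     (4, 10, [3, 3, 3])], [(1, 9, [1, 1, 1]), (2, 18, [0, 2, 3])]]⟩,
   ⟨[1], [1], [[(1, 13, [0, 3])], [(1, 3, [1, 2]), (2, 13, [0, 3])]]⟩,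
   ⟨[1], [1], [[(1, 3, [1, 2]), (2, 13, [0, 3])], [(1, 3, [1, 2]), (2, 13, [0, 3])]]⟩,
   ⟨[1, 2], [], [[(1, 5, [1]), (1, 5, [2])]]⟩,
   ⟨[1, 2], [], [[(1, 5, [1]), (1, 5, [2])]]⟩],
  [⟨[], [], [[(1, 1, [])]]⟩,
   ⟨[1], [1], [[(2, 1, []), (1, 16, [1, 2])], [(1, 1, [])]]⟩,
   ⟨[1], [1], [[(1, 1, [])], [(1, 1, [])]]⟩,
   ⟨[], [], [[(1, 1, [])]]⟩,
   ⟨[2], [], [[(1, 2, [1]), (3, 18, [0, 1, 2]), (4, 9, [0, 0, 0])]]⟩,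
   ⟨[2], [], [[(1, 2, [1]), (3, 18, [0, 1, 2]), (4, 9, [0, 0, 0])]]⟩,
   ⟨[1], [1], [[(1, 3, [1, 2]), (1, 13, [0, 3])], [(1, 3, [0, 1])]]⟩,
   ⟨[1], [1], [[(2, 0, [0]), (1, 15, [1])], [(1, 0, [1]), (1, 5, [2])]]⟩,
   ⟨[1], [1], [[(6, 0, [0]), (1, 0, [1]), (1, 15, [2]), (2, 5, [1])], [(1, 0, [1]),
     (1, 5, [2])]]⟩,
   ⟨[], [], [[(1, 1, [])]]⟩,
   ⟨[], [], [[(1, 1, [])]]⟩],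
  [⟨[], [], [[(1, 1, [])]]⟩,
   ⟨[], [], [[(1, 1, [])]]⟩,
   ⟨[1], [1], [[(1, 1, [])], [(2, 1, []), (1, 16, [1, 2])]]⟩,
   ⟨[2], [], [[(4, 10, [2, 2, 2]), (1, 2, [1]), (3, 18, [0, 1, 2])]]⟩,
   ⟨[2], [], [[(4, 10, [2, 2, 2]), (1, 2, [1]), (3, 18, [0, 1, 2])]]⟩,
   ⟨[1], [1], [[(1, 3, [1, 2]), (2, 13, [0, 3])], [(1, 13, [0, 3])]]⟩,
   ⟨[1], [1], [[(1, 0, [3]), (1, 15, [2])], [(5, 0, [3]), (3, 15, [1])]]⟩,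
   ⟨[1], [1], [[(3, 0, [3]), (2, 15, [2]), (1, 15, [1]), (1, 5, [1])], [(1, 0, [1]),
     (5, 0, [3]), (1, 15, [2]), (1, 5, [1])]]⟩,
   ⟨[], [], [[(1, 1, [])]]⟩,
   ⟨[], [], [[(1, 1, [])]]⟩],
  [⟨[], [], [[(1, 1, [])]]⟩,
   ⟨[1], [1], [[(1, 1, [])], [(1, 1, [])]]⟩,
   ⟨[1, 2], [], [[(3, 10, [3, 3, 3]), (1, 2, [1]), (2, 18, [0, 2, 3])]]⟩,
   ⟨[1, 2], [], [[(3, 10, [3, 3, 3]), (1, 2, [1]), (2, 18, [0, 2, 3])]]⟩,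
   ⟨[1, 3], [], [[(7, 4, [1, 2]), (11, 13, [0, 3])]]⟩,
   ⟨[1], [1], [[(1, 0, [3]), (1, 15, [2])], [(2, 0, [3]), (1, 15, [1])]]⟩,
   ⟨[1], [1], [[(1, 0, [3]), (2, 5, [2])], [(2, 0, [3]), (1, 15, [1])]]⟩,
   ⟨[], [], [[(1, 1, [])]]⟩,
   ⟨[], [], [[(1, 1, [])]]⟩],
  [⟨[], [], [[(1, 1, [])]]⟩,
   ⟨[1, 3], [], [[(1, 2, [2]), (1, 2, [1]), (2, 9, [0, 0, 0])]]⟩,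
   ⟨[1, 3], [], [[(1, 2, [2]), (1, 2, [1]), (2, 9, [0, 0, 0])]]⟩,
   ⟨[1, 3], [], [[(7, 3, [1, 2]), (11, 13, [0, 3])]]⟩,
   ⟨[1], [1], [[(2, 0, [0]), (1, 15, [1])], [(1, 0, [1]), (1, 5, [2])]]⟩,
   ⟨[1], [1], [[(6, 0, [0]), (1, 0, [1]), (1, 15, [2]), (2, 5, [1])], [(1, 0, [1]),
     (1, 5, [2])]]⟩,
   ⟨[], [], [[(1, 1, [])]]⟩,
   ⟨[], [], [[(1, 1, [])]]⟩],
  [⟨[], [], [[(1, 13, [0, 1])]]⟩,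
   ⟨[], [], [[(1, 13, [0, 1])]]⟩,
   ⟨[], [1], [[(1, 5, [1])]]⟩,
   ⟨[], [], [[(1, 1, [])]]⟩,
   ⟨[], [], [[(1, 1, [])]]⟩,
   ⟨[], [2], [[(1, 10, [2, 2, 2]), (1, 9, [0, 0, 0]), (2, 18, [0, 1, 2])]]⟩,
   ⟨[], [2], [[(1, 10, [2, 2, 2]), (1, 9, [0, 0, 0]), (2, 18, [0, 1, 2])]]⟩],
  [⟨[], [], [[(1, 13, [0, 1])]]⟩,
   ⟨[], [1], [[(1, 5, [1])]]⟩,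
   ⟨[], [], [[(1, 1, [])]]⟩,
   ⟨[], [], [[(1, 1, [])]]⟩,
   ⟨[], [2], [[(1, 10, [2, 2, 2]), (1, 9, [0, 0, 0]), (2, 18, [0, 1, 2])]]⟩,
   ⟨[], [2], [[(1, 10, [2, 2, 2]), (1, 9, [0, 0, 0]), (2, 18, [0, 1, 2])]]⟩],
  [⟨[1], [1], [[(1, 8, [1, 2])], [(1, 8, [1, 2])]]⟩,
   ⟨[1], [1], [[(1, 2, [1])], [(2, 2, [1]), (1, 2, [2]), (1, 10, [3, 3, 3]), (1, 18, [1, 2, 3]),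
     (1, 18, [2, 2, 3])]]⟩,
   ⟨[1], [1], [[(1, 9, [1, 1, 1]), (1, 18, [0, 2, 3])], [(2, 2, [1]), (1, 2, [2]),
     (3, 18, [0, 2, 3]), (1, 10, [3, 3, 3])]]⟩,
   ⟨[1], [1], [[(1, 13, [0, 3])], [(3, 13, [1, 3]), (3, 13, [0, 3]), (1, 4, [2, 2]),
     (1, 3, [2, 2])]]⟩,
   ⟨[1], [1], [[(1, 13, [0, 3])], [(1, 4, [2, 2]), (2, 13, [0, 3]), (1, 3, [2, 2]),
     (4, 13, [1, 3])]]⟩],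
  [⟨[1], [1], [[(1, 13, [0, 3])], [(1, 13, [0, 3])]]⟩,
   ⟨[1], [1], [[(1, 3, [1, 2]), (1, 13, [0, 3])], [(1, 13, [0, 3])]]⟩,
   ⟨[1, 2], [], [[(1, 5, [1]), (1, 5, [2])]]⟩,
   ⟨[1, 2], [], [[(1, 5, [1]), (1, 5, [2])]]⟩],
  [⟨[1], [1], [[(1, 3, [1, 2]), (1, 13, [0, 3])], [(1, 3, [1, 2]), (1, 13, [0, 3])]]⟩,
   ⟨[1, 2], [], [[(1, 5, [1]), (1, 5, [2])]]⟩,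
   ⟨[1, 2], [], [[(1, 5, [1]), (1, 5, [2])]]⟩],
  [⟨[], [], [[(1, 1, [])]]⟩,
   ⟨[], [], [[(1, 1, [])]]⟩],
  [⟨[], [], [[(1, 1, [])]]⟩]]


/-- The model number `i`. -/
def model (i : ℕ) : Model := models.getD i ⟨0, 0, []⟩

/-- Thirty-six times the maximal normalized total. -/
def maxTotal (r : ℕ) : ℕ := [0, 56, 84, 144, 216].getD r 0

/-- Whether the product `ρ` of models is bounded by a mixture of models of class `r`. -/
def checkMixture (T r wrap : ℕ) (ρ : Profile) (mix : List (ℕ × ℕ × List ℕ)) : Bool :=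
  Nat.ble (total (fun _ _ => 1) ρ) (36 * wrap * maxTotal r) &&
  (mix.all fun x => Nat.beq (model x.2.1).cls r &&
    Nat.beq (model x.2.1).letters x.2.2.length && x.2.2.all (Nat.ble · T) &&
    isSorted x.2.2 && Nat.blt x.2.1 20) &&
  Nat.blt 0 (mix.map fun x => x.1).sum &&
  dominates T (scale (mix.map fun x => x.1).sum ρ)
    (mix.flatMap fun x => scale (36 * wrap * x.1) (relabel (val T x.2.2) (model x.2.1).words))

/-- Whether `b` bounds the product of two models. -/
def checkBound (G H : Model) (b : Bound) : Bool :=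
  let wrap := bif Nat.ble (G.cls + H.cls) 4 then 1 else 6
  let r := bif Nat.ble (G.cls + H.cls) 4 then G.cls + H.cls else G.cls + H.cls - 4
  let μ := compress (coarsen b.left G.words)
  let ν := compress (coarsen b.right H.words)
  let T := b.left.length + b.right.length + 1
  let S := shuffles (b.left.length + b.right.length) b.left.length
  (G.words.all fun x => enlarges G.letters b.left x.2.1 && enlarges G.letters b.left x.2.2) &&
  (H.words.all fun x => enlarges H.letters b.right x.2.1 && enlarges H.letters b.right x.2.2) &&
  isSorted b.left && isSorted b.right &&
  Nat.beq b.mixtures.length S.length &&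
  (S.zip b.mixtures).all fun x =>
    checkMixture T r wrap
      (prod (relabel (val T (select true x.1 (List.range' 1 (T - 1)))) μ)
        (relabel (val T (select false x.1 (List.range' 1 (T - 1)))) ν)) x.2

/-- Whether all products of models are bounded. -/
def checkAll : Bool :=
  (List.range 20).all fun i => (List.range (20 - i)).all fun d =>
    checkBound (model i) (model (i + d)) ((bounds.getD i []).getD d ⟨[], [], []⟩)

theorem checkAll_eq : checkAll = true := by decide +kernel

/-- Functions that increase when an end is made easier to join. -/
def EndMono (f : WordEnd → ℕ) : Prop :=
  ∀ a b, a ≤ b → f (true, a) ≤ f (true, b) ∧ f (false, b) ≤ f (false, a)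

/-- The cone generated by the products of two functions in `EndMono`. -/
inductive IsContext : (WordEnd → WordEnd → ℕ) → Prop
  | zero : IsContext fun _ _ => 0
  | mul {f g} (hf : EndMono f) (hg : EndMono g) : IsContext fun a b => f a * g b
  | add {Φ Ψ} (hΦ : IsContext Φ) (hΨ : IsContext Ψ) : IsContext fun a b => Φ a b + Ψ a b

theorem EndMono.const (c : ℕ) : EndMono fun _ => c := fun _ _ _ => ⟨le_rfl, le_rfl⟩

theorem EndMono.mul {f g : WordEnd → ℕ} (hf : EndMono f) (hg : EndMono g) :
    EndMono fun e => f e * g e := fun a b h =>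
  ⟨Nat.mul_le_mul (hf a b h).1 (hg a b h).1, Nat.mul_le_mul (hf a b h).2 (hg a b h).2⟩

theorem EndMono.comp {f : WordEnd → ℕ} (hf : EndMono f) {σ : ℕ → ℕ} (hσ : Monotone σ) :
    EndMono fun e => f (e.1, σ e.2) := fun _ _ h => hf _ _ (hσ h)

theorem joins_true_iff (a b : ℕ) (s : Bool) : joins (true, a) (s, b) = (!s && decide (b < a)) := by
  rw [Bool.eq_iff_iff]
  cases s <;> simp [joins, Nat.blt_eq]

theorem joins_false_iff (a b : ℕ) (s : Bool) : joins (false, a) (s, b) = (s && decide (a < b)) := by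
  rw [Bool.eq_iff_iff]
  cases s <;> simp [joins, Nat.blt_eq]

theorem joins_comm (e f : WordEnd) : joins e f = joins f e := by
  obtain ⟨s, a⟩ := e
  obtain ⟨t, b⟩ := f
  cases s <;> cases t <;> simp [joins_true_iff, joins_false_iff]

theorem endMono_joins (f : WordEnd) : EndMono fun e => (joins e f).toNat := by
  obtain ⟨t, c⟩ := f
  intro a b h
  constructor <;> apply Bool.toNat_le_toNat <;> rw [Bool.le_iff_imp] <;>
    cases t <;> simp [joins_true_iff, joins_false_iff] <;> omega

theorem endMono_joins_right (f : WordEnd) : EndMono fun e => (joins f e).toNat := by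
  simpa only [joins_comm f] using endMono_joins f

theorem joins_of_joins_relabel {σ : ℕ → ℕ} (hσ : Monotone σ) (e f : WordEnd) :
    (joins (e.1, σ e.2) (f.1, σ f.2)).toNat ≤ (joins e f).toNat := by
  obtain ⟨s, a⟩ := e
  obtain ⟨t, b⟩ := f
  apply Bool.toNat_le_toNat
  rw [Bool.le_iff_imp]
  cases s <;> cases t <;> simp [joins_true_iff, joins_false_iff] <;> exact hσ.reflect_lt

theorem IsContext.comp {Φ} (hΦ : IsContext Φ) {σ : ℕ → ℕ} (hσ : Monotone σ) :
    IsContext fun a b => Φ (a.1, σ a.2) (b.1, σ b.2) := by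
  induction hΦ with
  | zero => exact .zero
  | mul hf hg => exact .mul (hf.comp hσ) (hg.comp hσ)
  | add _ _ h₁ h₂ => exact .add h₁ h₂

theorem IsContext.one : IsContext fun _ _ => 1 := .mul (.const 1) (.const 1)

theorem IsContext.smul {Φ} (hΦ : IsContext Φ) (c : ℕ) : IsContext fun a b => c * Φ a b := by
  induction hΦ with
  | zero => exact .zero
  | mul hf hg => simpa only [mul_assoc] using IsContext.mul ((EndMono.const c).mul hf) hg
  | add _ _ h₁ h₂ => simpa only [mul_add] using IsContext.add h₁ h₂

theorem IsContext.mono {Φ} (hΦ : IsContext Φ) {a b c d : WordEnd} (hac : a.1 = c.1)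
    (hbd : b.1 = d.1) (h₁ : bif a.1 then a.2 ≤ c.2 else c.2 ≤ a.2)
    (h₂ : bif b.1 then b.2 ≤ d.2 else d.2 ≤ b.2) : Φ a b ≤ Φ c d := by
  have key : ∀ {f : WordEnd → ℕ}, EndMono f → ∀ {a c : WordEnd}, a.1 = c.1 →
      (bif a.1 then a.2 ≤ c.2 else c.2 ≤ a.2) → f a ≤ f c := by
    rintro f hf ⟨s, a⟩ ⟨t, c⟩ h h'
    obtain rfl : s = t := h
    cases s
    · exact (hf _ _ h').2
    · exact (hf _ _ h').1
  induction hΦ with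
  | zero => exact le_rfl
  | mul hf hg => exact Nat.mul_le_mul (key hf hac h₁) (key hg hbd h₂)
  | add _ _ h₁ h₂ => exact Nat.add_le_add h₁ h₂

@[simp] theorem total_nil (Φ : WordEnd → WordEnd → ℕ) : total Φ [] = 0 := rfl

@[simp] theorem total_cons (Φ : WordEnd → WordEnd → ℕ) (x : ℕ × WordEnd × WordEnd) (μ : Profile) :
    total Φ (x :: μ) = x.1 * Φ x.2.1 x.2.2 + total Φ μ := by simp [total]

@[simp] theorem total_append (Φ : WordEnd → WordEnd → ℕ) (μ ν : Profile) :
    total Φ (μ ++ ν) = total Φ μ + total Φ ν := by simp [total]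

theorem total_add (Φ Ψ : WordEnd → WordEnd → ℕ) (μ : Profile) :
    total (fun a b => Φ a b + Ψ a b) μ = total Φ μ + total Ψ μ := by
  induction μ with
  | nil => rfl
  | cons x μ ih => simp only [total_cons, ih]; ring

theorem total_zero (μ : Profile) : total (fun _ _ => 0) μ = 0 := by
  simp [total]

theorem total_mul (c : ℕ) (Φ : WordEnd → WordEnd → ℕ) (μ : Profile) :
    total (fun a b => c * Φ a b) μ = c * total Φ μ := by
  induction μ with
  | nil => rfl
  | cons x μ ih => simp only [total_cons, ih]; ring

theorem total_scale (c : ℕ) (Φ : WordEnd → WordEnd → ℕ) (μ : Profile) :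
    total Φ (scale c μ) = c * total Φ μ := by
  induction μ with
  | nil => rfl
  | cons x μ ih =>
    simp only [scale, List.map_cons, total_cons] at ih ⊢
    rw [ih]; ring

theorem total_relabel (σ : ℕ → ℕ) (Φ : WordEnd → WordEnd → ℕ) (μ : Profile) :
    total Φ (relabel σ μ) = total (fun a b => Φ (a.1, σ a.2) (b.1, σ b.2)) μ := by
  simp [total, relabel, Function.comp_def]

theorem total_mono {Φ Ψ : WordEnd → WordEnd → ℕ} {μ : Profile}
    (h : ∀ x ∈ μ, Φ x.2.1 x.2.2 ≤ Ψ x.2.1 x.2.2) : total Φ μ ≤ total Ψ μ := by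
  induction μ with
  | nil => exact le_rfl
  | cons x μ ih =>
    simp only [total_cons]
    exact Nat.add_le_add (Nat.mul_le_mul_left _ (h x (by simp)))
      (ih fun y hy => h y (List.mem_cons_of_mem _ hy))

theorem total_comm (F : WordEnd → WordEnd → WordEnd → WordEnd → ℕ) (μ ν : Profile) :
    total (fun a b => total (fun c d => F a b c d) ν) μ =
      total (fun c d => total (fun a b => F a b c d) μ) ν := by
  induction μ with
  | nil => simp [total_zero]
  | cons x μ ih => simp only [total_cons, total_add, ih, total_mul]

theorem total_prod (Φ : WordEnd → WordEnd → ℕ) (μ ν : Profile) :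
    total Φ (prod μ ν) = total (fun a b => total (fun c d =>
      (joins b c).toNat * Φ a d + (joins d a).toNat * Φ c b) ν) μ := by
  induction μ with
  | nil => rfl
  | cons x μ ih =>
    have h : ∀ ν : Profile, total Φ (ν.flatMap fun y =>
        (bif joins x.2.2 y.2.1 then [(x.1 * y.1, x.2.1, y.2.2)] else []) ++
        (bif joins y.2.2 x.2.1 then [(x.1 * y.1, y.2.1, x.2.2)] else [])) =
        x.1 * total (fun c d =>
          (joins x.2.2 c).toNat * Φ x.2.1 d + (joins d x.2.1).toNat * Φ c x.2.2) ν := by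
      intro ν
      induction ν with
      | nil => rfl
      | cons y ν ih =>
        rw [List.flatMap_cons, total_append, ih, total_cons, mul_add, total_append]
        cases joins x.2.2 y.2.1 <;> cases joins y.2.2 x.2.1 <;> simp <;> ring
    rw [total_cons, ← ih, ← h ν]
    simp only [prod, List.flatMap_cons, total_append]

theorem total_prod_comm (Φ : WordEnd → WordEnd → ℕ) (μ ν : Profile) :
    total Φ (prod μ ν) = total Φ (prod ν μ) := by
  rw [total_prod, total_prod, total_comm]
  simp only [add_comm]

theorem IsContext.prod {Φ} (hΦ : IsContext Φ) (ν : Profile) : IsContext fun a b =>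
    total (fun c d => (joins b c).toNat * Φ a d + (joins d a).toNat * Φ c b) ν := by
  induction hΦ with
  | zero => simpa [total_zero] using IsContext.zero
  | @mul f g hf hg =>
    induction ν with
    | nil => exact .zero
    | cons y ν ih =>
      simp only [total_cons]
      refine .add (.smul ?_ _) ih
      have h₁ := IsContext.mul hf ((endMono_joins y.2.1).mul (EndMono.const (g y.2.2)))
      have h₂ := IsContext.mul ((endMono_joins_right y.2.2).mul (EndMono.const (f y.2.1))) hg
      convert h₁.add h₂ using 4 <;> ring
  | add _ _ h₁ h₂ =>
    have h := h₁.add h₂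
    simp only [← total_add] at h
    convert h using 5
    funext
    ring

/-- The indicator function of an upper set of ends. -/
def upperInd (T : ℕ) (i : Bool × ℕ) (e : WordEnd) : ℕ := if e.1 = i.1 ∧ i.2 < rank T e then 1 else 0

theorem lastUpper_firstUpper_ranks (T : ℕ) (t t' : Bool) (r r' : ℕ) (μ : Profile) :
    lastUpper r' (firstUpper r (ranks T t t' μ)) =
      total (fun a b => upperInd T (t, r) a * upperInd T (t', r') b) μ := by
  induction μ with
  | nil => rfl
  | cons x μ ih =>
    obtain ⟨w, ⟨s, a⟩, s', b⟩ := x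
    rw [total_cons, ← ih]
    have hs : (bif t then s else !s) = (s == t) := by cases s <;> cases t <;> rfl
    have hs' : (bif t' then s' else !s') = (s' == t') := by cases s' <;> cases t' <;> rfl
    rw [ranks, List.foldr_cons, ← ranks]
    simp only [hs, hs', upperInd]
    by_cases h₁ : s = t
    · by_cases h₂ : s' = t'
      · simp only [h₁, h₂, beq_self_eq_true, Bool.and_self, cond_true, true_and]
        rw [firstUpper, List.foldr_cons, ← firstUpper]
        by_cases h₃ : r < rank T (t, a)
        · rw [Nat.blt_eq.mpr h₃, cond_true, lastUpper, List.foldr_cons, ← lastUpper]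
          by_cases h₄ : r' < rank T (t', b)
          · rw [Nat.blt_eq.mpr h₄]; simp [h₃, h₄]
          · rw [Bool.eq_false_iff.2 (mt Nat.blt_eq.mp h₄)]; simp [h₄]
        · rw [Bool.eq_false_iff.2 (mt Nat.blt_eq.mp h₃)]; simp [h₃]
      · rw [beq_false_of_ne h₂]; simp [h₂]
    · rw [beq_false_of_ne h₁]; simp [h₁]

theorem dominates_upperInd {T : ℕ} {μ ν : Profile} (h : dominates T μ ν = true) (t t' : Bool)
    {r r' : ℕ} (hr : r < T) (hr' : r' < T) :
    total (fun a b => upperInd T (t, r) a * upperInd T (t', r') b) μ ≤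
      total (fun a b => upperInd T (t, r) a * upperInd T (t', r') b) ν := by
  simp only [dominates, Bool.and_eq_true, List.all_eq_true, Bool.or_eq_true] at h
  rw [← lastUpper_firstUpper_ranks, ← lastUpper_firstUpper_ranks]
  rcases h.2 t (by cases t <;> simp) t' (by cases t' <;> simp) with h | h
  · rw [List.isEmpty_iff] at h
    rw [h]
    exact Nat.zero_le _
  · simp only [ranksLe, List.all_eq_true, List.mem_range] at h
    exact Nat.le_of_ble_eq_true (h r hr r' hr')

theorem sum_range_increments {g : ℕ → ℕ} (hg : Monotone g) (m : ℕ) :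
    ∑ r ∈ Finset.range (m + 1), (if r = 0 then g 1 else g (r + 1) - g r) = g (m + 1) := by
  induction m with
  | zero => simp
  | succ m ih =>
    rw [Finset.sum_range_succ, ih, if_neg (Nat.succ_ne_zero m)]
    exact Nat.add_sub_cancel' (hg (Nat.le_succ _))

theorem EndMono.exists_steps {f : WordEnd → ℕ} (hf : EndMono f) (T : ℕ) :
    ∃ d : Bool × ℕ → ℕ, ∀ e : WordEnd, e.2 ≤ T →
      ∑ i ∈ Finset.univ ×ˢ Finset.range T, d i * upperInd T i e =
        if 0 < rank T e then f e else 0 := by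
  let g : Bool → ℕ → ℕ := fun t i => bif t then f (true, i) else f (false, T - i)
  have hg : ∀ t, Monotone (g t) := by
    rintro (_ | _) a b h
    · exact (hf _ _ (Nat.sub_le_sub_left h T)).2
    · exact (hf _ _ h).1
  refine ⟨fun i => if i.2 = 0 then g i.1 1 else g i.1 (i.2 + 1) - g i.1 i.2, ?_⟩
  rintro ⟨t, a⟩ ha
  have hrank : rank T (t, a) ≤ T := by cases t <;> simp [rank]; exact ha
  have hval : g t (rank T (t, a)) = f (t, a) := by
    cases t
    · simp only [g, rank, cond_false]
      rw [Nat.sub_sub_self ha]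
    · rfl
  rw [Finset.sum_product, Finset.sum_eq_single t]
  · rw [← hval]
    have hsub : Finset.range (rank T (t, a)) ⊆ Finset.range T :=
      Finset.range_subset_range.2 hrank
    rw [← Finset.sum_subset hsub]
    · rcases hm : rank T (t, a) with _ | m
      · simp
      · rw [if_pos (Nat.succ_pos m), ← sum_range_increments (hg t) m]
        refine Finset.sum_congr rfl fun r hr => ?_
        have : r < rank T (t, a) := by rw [hm]; exact Finset.mem_range.1 hr
        simp [upperInd, this]
    · intro r _ hr
      simp only [upperInd, Finset.mem_range] at hr ⊢
      simp [hr]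
  · intro s _ hs
    exact Finset.sum_eq_zero fun r _ => by simp [upperInd, hs.symm]
  · simp

theorem total_sum {ι : Type*} (s : Finset ι) (Φ : ι → WordEnd → WordEnd → ℕ) (μ : Profile) :
    total (fun a b => ∑ i ∈ s, Φ i a b) μ = ∑ i ∈ s, total (Φ i) μ := by
  induction μ with
  | nil => simp
  | cons x μ ih => simp only [total_cons, ih, Finset.sum_add_distrib, Finset.mul_sum]

theorem le_of_boundedBy {T : ℕ} {μ : Profile} (h : boundedBy T μ = true)
    {x : ℕ × WordEnd × WordEnd} (hx : x ∈ μ) : x.2.1.2 ≤ T ∧ x.2.2.2 ≤ T := by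
  simp only [boundedBy, List.all_eq_true, Bool.and_eq_true, Nat.ble_eq] at h
  exact h x hx

theorem total_le_of_dominates {T : ℕ} {μ ν : Profile} (h : dominates T μ ν = true)
    {Φ : WordEnd → WordEnd → ℕ} (hΦ : IsContext Φ) : total Φ μ ≤ total Φ ν := by
  induction hΦ with
  | zero => simp [total_zero]
  | add _ _ h₁ h₂ => rw [total_add, total_add]; exact Nat.add_le_add h₁ h₂
  | @mul f g hf hg =>
    obtain ⟨d, hd⟩ := hf.exists_steps T
    obtain ⟨d', hd'⟩ := hg.exists_steps T
    let I : Finset (Bool × ℕ) := Finset.univ ×ˢ Finset.range T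
    let F : WordEnd → ℕ := fun e => ∑ i ∈ I, d i * upperInd T i e
    let G : WordEnd → ℕ := fun e => ∑ i ∈ I, d' i * upperInd T i e
    have expand : ∀ ρ : Profile, total (fun a b => F a * G b) ρ =
        ∑ i ∈ I, ∑ j ∈ I, d i * d' j * total (fun a b => upperInd T i a * upperInd T j b) ρ := by
      intro ρ
      simp only [← total_mul, ← total_sum]
      congr 1
      funext a b
      rw [Finset.sum_mul_sum]
      refine Finset.sum_congr rfl fun i _ => Finset.sum_congr rfl fun j _ => ?_
      ring
    have hdom := h
    simp only [dominates, Bool.and_eq_true] at h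
    obtain ⟨⟨⟨hμ, hν⟩, hpos⟩, -⟩ := h
    calc total (fun a b => f a * g b) μ ≤ total (fun a b => F a * G b) μ := by
          refine total_mono fun x hx => ?_
          have hb := le_of_boundedBy hμ hx
          simp only [ranksPos, List.all_eq_true, Bool.and_eq_true, Nat.blt_eq] at hpos
          have hp := hpos x hx
          simp only [F, G, I, hd _ hb.1, hd' _ hb.2, if_pos hp.1, if_pos hp.2, le_refl]
      _ ≤ total (fun a b => F a * G b) ν := by
          rw [expand, expand]
          refine Finset.sum_le_sum fun i hi => Finset.sum_le_sum fun j hj => ?_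
          simp only [I, Finset.mem_product, Finset.mem_range] at hi hj
          exact Nat.mul_le_mul_left _ (dominates_upperInd hdom i.1 j.1 hi.2 hj.2)
      _ ≤ total (fun a b => f a * g b) ν := by
          refine total_mono fun x hx => ?_
          have hb := le_of_boundedBy hν hx
          simp only [F, G, I, hd _ hb.1, hd' _ hb.2]
          exact Nat.mul_le_mul (by split <;> simp) (by split <;> simp)

theorem eq_of_sameEnd {e f : WordEnd} (h : sameEnd e f = true) : e = f := by
  obtain ⟨s, a⟩ := e
  obtain ⟨t, b⟩ := f
  simp only [sameEnd, Bool.and_eq_true, Nat.beq_eq] at h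
  obtain ⟨rfl, h⟩ := h
  cases s <;> cases t <;> simp_all

theorem total_insertWord (Φ : WordEnd → WordEnd → ℕ) (x : ℕ × WordEnd × WordEnd) (μ : Profile) :
    total Φ (insertWord x μ) = x.1 * Φ x.2.1 x.2.2 + total Φ μ := by
  induction μ with
  | nil => simp [insertWord]
  | cons y μ ih =>
    rw [insertWord]
    cases h : sameEnd x.2.1 y.2.1 && sameEnd x.2.2 y.2.2
    · simp only [cond_false, total_cons, ih]; ring
    · rw [Bool.and_eq_true] at h
      simp only [cond_true, total_cons, eq_of_sameEnd h.1, eq_of_sameEnd h.2]; ring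

theorem total_compress (Φ : WordEnd → WordEnd → ℕ) (μ : Profile) :
    total Φ (compress μ) = total Φ μ := by
  induction μ with
  | nil => rfl
  | cons x μ ih => rw [compress, List.foldr_cons, ← compress, total_insertWord, ih, total_cons]

theorem pairwise_of_isSorted : ∀ {l : List ℕ}, isSorted l = true → l.Pairwise (· ≤ ·)
  | [], _ => .nil
  | [a], _ => List.pairwise_singleton _ a
  | a :: b :: l, h => by
    simp only [isSorted, Bool.and_eq_true, Nat.ble_eq] at h
    have ih := pairwise_of_isSorted h.2
    refine List.pairwise_cons.2 ⟨fun c hc => ?_, ih⟩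
    rcases List.mem_cons.1 hc with rfl | hc
    · exact h.1
    · exact h.1.trans (List.rel_of_pairwise_cons ih hc)

/-- Increasing sequences of letters bounded by `N`. -/
def IsPlacement (N : ℕ) (A : List ℕ) : Prop := A.Pairwise (· ≤ ·) ∧ ∀ a ∈ A, a ≤ N

theorem val_le {N : ℕ} {A : List ℕ} (hA : IsPlacement N A) (i : ℕ) : val N A i ≤ N := by
  rw [val, List.getD_eq_getElem?_getD]
  rcases h : (0 :: A)[i]? with _ | a
  · exact le_rfl
  · rcases List.mem_cons.1 (List.mem_of_getElem? h) with rfl | h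
    · exact Nat.zero_le _
    · exact hA.2 _ h

theorem val_monotone {N : ℕ} {A : List ℕ} (hA : IsPlacement N A) : Monotone (val N A) := by
  intro i j hij
  rcases lt_or_ge j (0 :: A).length with hj | hj
  · have hp : (0 :: A).Pairwise (· ≤ ·) :=
      List.pairwise_cons.2 ⟨fun _ _ => Nat.zero_le _, hA.1⟩
    rw [val, val, List.getD_eq_getElem _ _ hj, List.getD_eq_getElem _ _ (hij.trans_lt hj)]
    rcases hij.eq_or_lt with rfl | h
    · exact le_rfl
    · exact List.pairwise_iff_getElem.1 hp i j _ _ h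
  · have h : val N A j = N := List.getD_eq_default _ _ hj
    rw [h]
    exact val_le hA i

theorem val_map (N : ℕ) (R l : List ℕ) (i : ℕ) :
    val N (l.map (val N R)) i = val N R (val (R.length + 1) l i) := by
  have h : val N R (R.length + 1) = N := List.getD_eq_default _ _ (by simp)
  cases i with
  | zero => rfl
  | succ i =>
    rcases lt_or_ge i l.length with hi | hi
    · rw [val, List.getD_cons_succ, val.eq_def (R.length + 1), List.getD_cons_succ,
        List.getD_eq_getElem _ _ hi, List.getD_eq_getElem _ _ (by simpa using hi),
        List.getElem_map]
    · rw [val, List.getD_cons_succ, val.eq_def (R.length + 1), List.getD_cons_succ,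
        List.getD_eq_default _ _ hi, List.getD_eq_default _ _ (by simpa using hi), h]

theorem IsPlacement.map {N : ℕ} {R l : List ℕ} (hR : IsPlacement N R) (hl : l.Pairwise (· ≤ ·)) :
    IsPlacement N (l.map (val N R)) := by
  refine ⟨List.pairwise_map.2 (hl.imp fun h => val_monotone hR h), fun a ha => ?_⟩
  obtain ⟨b, -, rfl⟩ := List.mem_map.1 ha
  exact val_le hR b

theorem map_val_range (N : ℕ) (R : List ℕ) : (List.range' 1 R.length).map (val N R) = R := by
  apply List.ext_getElem
  · simp
  · intro i h₁ h₂
    simp [val, Nat.add_comm 1 i, h₂]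

theorem select_map (f : ℕ → ℕ) (b : Bool) : ∀ (w : List Bool) (l : List ℕ),
    select b w (l.map f) = (select b w l).map f
  | [], _ => by simp [select]
  | _ :: _, [] => by simp [select]
  | c :: w, x :: l => by
    simp only [List.map_cons, select, select_map f b w l]
    cases b == c <;> rfl

theorem mem_shuffles : ∀ {n k : ℕ} {w : List Bool}, w.length = n → w.count true = k →
    w ∈ shuffles n k
  | 0, k, w, h, hk => by
    obtain rfl := List.length_eq_zero_iff.1 h
    obtain rfl : 0 = k := by simpa using hk
    simp [shuffles]
  | n + 1, k, [], h, _ => by simp at h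
  | n + 1, 0, true :: w, _, hk => by simp at hk
  | n + 1, k + 1, true :: w, h, hk => by
    simp only [List.count_cons_self, Nat.add_right_cancel_iff, List.length_cons] at h hk
    simp [shuffles, mem_shuffles h hk]
  | n + 1, 0, false :: w, h, hk => by
    simp only [List.length_cons, Nat.add_right_cancel_iff] at h
    simp only [shuffles, List.mem_map]
    exact ⟨w, mem_shuffles h (by simpa using hk), rfl⟩
  | n + 1, k + 1, false :: w, h, hk => by
    simp only [List.length_cons, Nat.add_right_cancel_iff] at h
    simp only [shuffles, List.mem_append, List.mem_map]
    exact .inr ⟨w, mem_shuffles h (by simpa using hk), rfl⟩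

theorem exists_merge : ∀ A B : List ℕ, A.Pairwise (· ≤ ·) → B.Pairwise (· ≤ ·) →
    ∃ (w : List Bool) (R : List ℕ), w.length = A.length + B.length ∧ w.count true = A.length ∧
      R.Perm (A ++ B) ∧ R.Pairwise (· ≤ ·) ∧ select true w R = A ∧ select false w R = B
  | [], [], _, _ => ⟨[], [], by simp [select]⟩
  | [], b :: B, hA, hB => by
    obtain ⟨w, R, h₁, h₂, h₃, h₄, h₅, h₆⟩ := exists_merge [] B hA (List.pairwise_cons.1 hB).2
    refine ⟨false :: w, b :: R, by simp_all, by simp_all, by simpa using h₃, ?_, ?_, ?_⟩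
    · refine List.pairwise_cons.2 ⟨fun c hc => ?_, h₄⟩
      exact (List.pairwise_cons.1 hB).1 c (by simpa using h₃.mem_iff.1 hc)
    · simpa [select] using h₅
    · simpa [select] using h₆
  | a :: A, [], hA, hB => by
    obtain ⟨w, R, h₁, h₂, h₃, h₄, h₅, h₆⟩ := exists_merge A [] (List.pairwise_cons.1 hA).2 hB
    refine ⟨true :: w, a :: R, by simp_all, by simp_all, by simpa using h₃, ?_, ?_, ?_⟩
    · refine List.pairwise_cons.2 ⟨fun c hc => ?_, h₄⟩
      exact (List.pairwise_cons.1 hA).1 c (by simpa using h₃.mem_iff.1 hc)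
    · simpa [select] using h₅
    · simpa [select] using h₆
  | a :: A, b :: B, hA, hB => by
    rcases le_total a b with hab | hab
    · obtain ⟨w, R, h₁, h₂, h₃, h₄, h₅, h₆⟩ :=
        exists_merge A (b :: B) (List.pairwise_cons.1 hA).2 hB
      refine ⟨true :: w, a :: R, ?_, by simp_all, h₃.cons a, ?_, ?_, ?_⟩
      · simp only [List.length_cons] at h₁ ⊢; omega
      · refine List.pairwise_cons.2 ⟨fun c hc => ?_, h₄⟩
        rcases List.mem_append.1 (h₃.mem_iff.1 hc) with h | h
        · exact (List.pairwise_cons.1 hA).1 c h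
        · rcases List.mem_cons.1 h with rfl | h
          · exact hab
          · exact hab.trans ((List.pairwise_cons.1 hB).1 c h)
      · simpa [select] using h₅
      · simpa [select] using h₆
    · obtain ⟨w, R, h₁, h₂, h₃, h₄, h₅, h₆⟩ :=
        exists_merge (a :: A) B hA (List.pairwise_cons.1 hB).2
      refine ⟨false :: w, b :: R, ?_, by simp_all, ?_, ?_, ?_, ?_⟩
      · simp only [List.length_cons] at h₁ ⊢; omega
      · exact (h₃.cons b).trans List.perm_middle.symm
      · refine List.pairwise_cons.2 ⟨fun c hc => ?_, h₄⟩
        rcases List.mem_append.1 (h₃.mem_iff.1 hc) with h | h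
        · rcases List.mem_cons.1 h with rfl | h
          · exact hab
          · exact hab.trans ((List.pairwise_cons.1 hA).1 c h)
        · exact (List.pairwise_cons.1 hB).1 c h
      · simpa [select] using h₅
      · simpa [select] using h₆
termination_by A B => A.length + B.length

theorem relabel_relabel (σ τ : ℕ → ℕ) (μ : Profile) :
    relabel σ (relabel τ μ) = relabel (σ ∘ τ) μ := by
  simp [relabel, Function.comp_def]

theorem total_prod_relabel_le {Φ} {σ : ℕ → ℕ} (hσ : Monotone σ)
    (μ ν : Profile) : total Φ (prod (relabel σ μ) (relabel σ ν)) ≤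
      total (fun a b => Φ (a.1, σ a.2) (b.1, σ b.2)) (prod μ ν) := by
  simp only [total_prod, total_relabel]
  exact total_mono fun x _ => total_mono fun y _ => Nat.add_le_add
    (Nat.mul_le_mul_right _ (joins_of_joins_relabel hσ _ _))
    (Nat.mul_le_mul_right _ (joins_of_joins_relabel hσ _ _))

theorem total_relabel_compress (Φ : WordEnd → WordEnd → ℕ) (σ : ℕ → ℕ) (μ : Profile) :
    total Φ (relabel σ (compress μ)) = total Φ (relabel σ μ) := by
  rw [total_relabel, total_compress, ← total_relabel]

theorem total_coarsen_ge {Φ} (hΦ : IsContext Φ) {N : ℕ} {A K : List ℕ} (hA : IsPlacement N A)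
    {μ : Profile} (h : ∀ x ∈ μ, enlarges A.length K x.2.1 = true ∧
      enlarges A.length K x.2.2 = true) :
    total Φ (relabel (val N A) μ) ≤
      total Φ (relabel (val N (K.map (val N A))) (coarsen K μ)) := by
  have key : ∀ e : WordEnd, enlarges A.length K e = true →
      bif e.1 then val N A e.2 ≤ val N (K.map (val N A)) (keepIndex K e)
        else val N (K.map (val N A)) (keepIndex K e) ≤ val N A e.2 := by
    rintro ⟨_ | _, a⟩ he <;> rw [val_map] <;> exact val_monotone hA (Nat.le_of_ble_eq_true he)
  have hco : total Φ (relabel (val N (K.map (val N A))) (coarsen K μ)) =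
      total (fun a b => Φ (a.1, val N (K.map (val N A)) (keepIndex K a))
        (b.1, val N (K.map (val N A)) (keepIndex K b))) μ := by
    simp [total, relabel, coarsen, Function.comp_def]
  rw [hco, total_relabel]
  exact total_mono fun x hx => hΦ.mono rfl rfl (key _ (h x hx).1) (key _ (h x hx).2)

theorem exists_le_of_weighted_sum_le {ι : Type*} {t : ℕ} {c f : ι → ℕ} {l : List ι}
    (hpos : 0 < (l.map c).sum) (h : (l.map c).sum * t ≤ (l.map fun x => c x * f x).sum) :
    ∃ x ∈ l, t ≤ f x := by
  by_contra! hlt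
  have : (l.map fun x => c x * f x).sum + (l.map c).sum ≤ (l.map c).sum * t := by
    clear h hpos
    induction l with
    | nil => simp
    | cons x l ih =>
      have h₁ := ih fun y hy => hlt y (List.mem_cons_of_mem _ hy)
      have h₂ := Nat.mul_le_mul_left (c x) (Nat.succ_le_of_lt (hlt x (by simp)))
      simp only [List.map_cons, List.sum_cons, add_mul]
      rw [Nat.mul_succ] at h₂
      omega
  omega

theorem total_flatMap {ι : Type*} (Φ : WordEnd → WordEnd → ℕ) (F : ι → Profile) (l : List ι) :
    total Φ (l.flatMap F) = (l.map fun x => total Φ (F x)).sum := by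
  induction l with
  | nil => rfl
  | cons x l ih => simp [ih]

theorem exists_of_checkMixture {T r wrap : ℕ} {ρ : Profile} {mix : List (ℕ × ℕ × List ℕ)}
    (h : checkMixture T r wrap ρ mix = true) {Φ} (hΦ : IsContext Φ) :
    ∃ g < 20, ∃ C, IsPlacement T C ∧ C.length = (model g).letters ∧ (model g).cls = r ∧
      total Φ ρ ≤ 36 * wrap * total Φ (relabel (val T C) (model g).words) := by
  simp only [checkMixture, Bool.and_eq_true, List.all_eq_true, Nat.ble_eq, Nat.beq_eq,
    Nat.blt_eq] at h
  obtain ⟨⟨⟨-, hmix⟩, hpos⟩, hdom⟩ := h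
  have hle := total_le_of_dominates hdom hΦ
  rw [total_scale, total_flatMap] at hle
  obtain ⟨x, hx, hxt⟩ := exists_le_of_weighted_sum_le (t := total Φ ρ)
    (c := fun x : ℕ × ℕ × List ℕ => x.1) (f := fun x =>
      36 * wrap * total Φ (relabel (val T x.2.2) (model x.2.1).words)) hpos (by
      refine hle.trans (le_of_eq ?_)
      congr 2
      funext x
      rw [total_scale]
      ring)
  obtain ⟨⟨⟨⟨h₁, h₂⟩, h₃⟩, h₄⟩, h₅⟩ := hmix x hx
  exact ⟨x.2.1, h₅, x.2.2, ⟨pairwise_of_isSorted h₄, h₃⟩, h₂.symm, h₁, hxt⟩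

theorem exists_of_checkBound {G H : Model} {b : Bound} (h : checkBound G H b = true) {N : ℕ}
    {A B : List ℕ} (hA : IsPlacement N A) (hB : IsPlacement N B) (hAl : A.length = G.letters)
    (hBl : B.length = H.letters) :
    ∃ wrap r, (wrap = 1 ∧ G.cls + H.cls = r ∧ r ≤ 4 ∨
        wrap = 6 ∧ G.cls + H.cls = r + 4) ∧
      total (fun _ _ => 1) (prod (relabel (val N A) G.words) (relabel (val N B) H.words)) ≤
        36 * wrap * maxTotal r ∧
      ∀ Φ, IsContext Φ → ∃ g < 20, ∃ C, IsPlacement N C ∧ C.length = (model g).letters ∧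
        (model g).cls = r ∧
        total Φ (prod (relabel (val N A) G.words) (relabel (val N B) H.words)) ≤
          36 * wrap * total Φ (relabel (val N C) (model g).words) := by
  simp only [checkBound, Bool.and_eq_true, List.all_eq_true, Nat.beq_eq] at h
  obtain ⟨⟨⟨⟨⟨hG, hH⟩, hK⟩, hL⟩, hlen⟩, hmix⟩ := h
  set wrap := bif Nat.ble (G.cls + H.cls) 4 then 1 else 6 with hwrap
  set r := bif Nat.ble (G.cls + H.cls) 4 then G.cls + H.cls else G.cls + H.cls - 4 with hr
  set K := b.left
  set L := b.right
  have hA' : IsPlacement N (K.map (val N A)) := hA.map (pairwise_of_isSorted hK)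
  have hB' : IsPlacement N (L.map (val N B)) := hB.map (pairwise_of_isSorted hL)
  obtain ⟨w, R, hw, hwc, hperm, hR, hsA, hsB⟩ := exists_merge _ _ hA'.1 hB'.1
  have hRlen : R.length = K.length + L.length := by simpa using hperm.length_eq
  have hRp : IsPlacement N R := ⟨hR, fun a ha => by
    rcases List.mem_append.1 (hperm.mem_iff.1 ha) with h | h
    · exact hA'.2 a h
    · exact hB'.2 a h⟩
  have hmem : w ∈ shuffles (K.length + L.length) K.length :=
    mem_shuffles (by simpa using hw) (by simpa using hwc)
  obtain ⟨n, hn, rfl⟩ := List.mem_iff_getElem.1 hmem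
  have hcheck := hmix ((shuffles (K.length + L.length) K.length)[n], b.mixtures[n])
    (List.mem_iff_getElem.2 ⟨n, by simp [hn, hlen], by simp⟩)
  set w := (shuffles (K.length + L.length) K.length)[n]
  simp only [Nat.add_sub_cancel] at hcheck
  set T := K.length + L.length + 1 with hT
  have hval : ∀ c, val N (select c w R) =
      val N R ∘ val T (select c w (List.range' 1 (K.length + L.length))) := by
    intro c
    funext i
    conv_lhs => rw [← map_val_range N R, select_map, val_map, hRlen]
    rfl
  set ρ := prod (relabel (val T (select true w (List.range' 1 (K.length + L.length))))
    (compress (coarsen K G.words)))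
    (relabel (val T (select false w (List.range' 1 (K.length + L.length))))
    (compress (coarsen L H.words)))
  have hle : ∀ Φ, IsContext Φ →
      total Φ (prod (relabel (val N A) G.words) (relabel (val N B) H.words)) ≤
        total (fun a b => Φ (a.1, val N R a.2) (b.1, val N R b.2)) ρ := by
    intro Φ hΦ
    calc _ ≤ total Φ (prod (relabel (val N (K.map (val N A))) (compress (coarsen K G.words)))
            (relabel (val N B) H.words)) := by
          rw [total_prod, total_prod, total_relabel_compress]
          exact total_coarsen_ge (hΦ.prod _) hA (by simpa only [hAl] using hG)
      _ ≤ total Φ (prod (relabel (val N (K.map (val N A))) (compress (coarsen K G.words)))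
            (relabel (val N (L.map (val N B))) (compress (coarsen L H.words)))) := by
          rw [total_prod_comm, total_prod_comm Φ _ (relabel _ (compress (coarsen L H.words))),
            total_prod, total_prod, total_relabel_compress _ _ (coarsen L H.words)]
          exact total_coarsen_ge (hΦ.prod _) hB (by simpa only [hBl] using hH)
      _ ≤ _ := by
          rw [← hsA, ← hsB, hval, hval, ← relabel_relabel, ← relabel_relabel]
          exact total_prod_relabel_le (val_monotone hRp) _ _
  refine ⟨wrap, r, ?_, ?_, ?_⟩
  · cases hc : Nat.ble (G.cls + H.cls) 4
    · right
      have : ¬ G.cls + H.cls ≤ 4 := by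
        rw [← Nat.ble_eq, hc]; simp
      rw [hwrap, hr, hc, cond_false, cond_false]
      omega
    · left
      have := Nat.le_of_ble_eq_true hc
      rw [hwrap, hr, hc, cond_true, cond_true]
      omega
  · refine (hle _ .one).trans ?_
    simp only [checkMixture, Bool.and_eq_true, Nat.ble_eq] at hcheck
    exact hcheck.1.1.1
  · intro Φ hΦ
    obtain ⟨g, hg, C, hC, hCl, hcls, htot⟩ :=
      exists_of_checkMixture hcheck (hΦ.comp (val_monotone hRp))
    refine ⟨g, hg, C.map (val N R), hRp.map hC.1, by simpa using hCl, hcls, ?_⟩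
    refine ((hle Φ hΦ).trans htot).trans (le_of_eq ?_)
    rw [total_relabel, total_relabel]
    simp only [val_map, hRlen, hT]

theorem exists_checkBound {i j : ℕ} (hij : i ≤ j) (hj : j < 20) :
    ∃ b, checkBound (model i) (model j) b = true := by
  have h := checkAll_eq
  simp only [checkAll, List.all_eq_true, List.mem_range] at h
  have := h i (by omega) (j - i) (by omega)
  rw [Nat.add_sub_cancel' hij] at this
  exact ⟨_, this⟩

theorem cls_model {i : ℕ} (hi : i < 20) : 1 ≤ (model i).cls ∧ (model i).cls ≤ 4 := by
  have h : (List.range 20).all fun i =>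
      Nat.ble 1 (model i).cls && Nat.ble (model i).cls 4 := by decide
  simp only [List.all_eq_true, List.mem_range, Bool.and_eq_true, Nat.ble_eq] at h
  exact h i hi

theorem prod_models_le {i j : ℕ} (hi : i < 20) (hj : j < 20) {N : ℕ} {A B : List ℕ}
    (hA : IsPlacement N A) (hB : IsPlacement N B) (hAl : A.length = (model i).letters)
    (hBl : B.length = (model j).letters) :
    ∃ e r, (model i).cls + (model j).cls = 4 * e + r ∧ 1 ≤ r ∧ r ≤ 4 ∧
      total (fun _ _ => 1) (prod (relabel (val N A) (model i).words)
        (relabel (val N B) (model j).words)) ≤ 36 * 6 ^ e * maxTotal r ∧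
      ∀ Φ, IsContext Φ → ∃ g < 20, ∃ C, IsPlacement N C ∧ C.length = (model g).letters ∧
        (model g).cls = r ∧
        total Φ (prod (relabel (val N A) (model i).words) (relabel (val N B) (model j).words)) ≤
          36 * 6 ^ e * total Φ (relabel (val N C) (model g).words) := by
  wlog hij : i ≤ j generalizing i j A B
  · simp only [total_prod_comm _ (relabel (val N A) _), add_comm (model i).cls]
    exact this hj hi hB hA hBl hAl (le_of_not_ge hij)
  obtain ⟨b, hb⟩ := exists_checkBound hij hj
  obtain ⟨wrap, r, hr, h₁, h₂⟩ := exists_of_checkBound hb hA hB hAl hBl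
  have hi' := cls_model hi
  have hj' := cls_model hj
  rcases hr with ⟨rfl, hr, hr4⟩ | ⟨rfl, hr⟩
  · exact ⟨0, r, by omega, by omega, hr4, h₁, h₂⟩
  · obtain ⟨g, hg, -, -, -, hgr, -⟩ := h₂ _ .one
    have := cls_model hg
    exact ⟨1, r, by omega, by omega, by omega, h₁, h₂⟩

/-- The profile of the alternating words of a tree. -/
def ends : BTree → Profile
  | leaf c => [(1, (true, c), (true, c)), (1, (false, c), (false, c))]
  | node l r => prod l.ends r.ends

/-- The profile of `t` is bounded by models with letters in `{0, …, N}`. -/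
def IsModeled (N : ℕ) (t : BTree) : Prop :=
  ∀ Φ, IsContext Φ → ∃ g < 20, ∃ A e, IsPlacement N A ∧ A.length = (model g).letters ∧
    t.leaves.length = 4 * e + (model g).cls ∧
    36 * total Φ t.ends ≤ 6 ^ e * total Φ (relabel (val N A) (model g).words)

theorem IsModeled.exists_prod {N : ℕ} {l r : BTree} (hl : IsModeled N l) (hr : IsModeled N r) {Φ}
    (hΦ : IsContext Φ) : ∃ i < 20, ∃ j < 20, ∃ A B e, IsPlacement N A ∧ IsPlacement N B ∧
      A.length = (model i).letters ∧ B.length = (model j).letters ∧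
      (node l r).leaves.length = 4 * e + ((model i).cls + (model j).cls) ∧
      36 * (36 * total Φ (node l r).ends) ≤ 6 ^ e * total Φ
        (prod (relabel (val N A) (model i).words) (relabel (val N B) (model j).words)) := by
  obtain ⟨i, hi, A, e, hA, hAl, hle, h₁⟩ := hl _ (hΦ.prod r.ends)
  rw [← total_prod, ← total_prod, total_prod_comm _ (relabel _ _)] at h₁
  obtain ⟨j, hj, B, f, hB, hBl, hlf, h₂⟩ := hr _ (hΦ.prod (relabel (val N A) (model i).words))
  rw [← total_prod, ← total_prod, total_prod_comm _ (relabel _ _)] at h₂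
  refine ⟨i, hi, j, hj, A, B, e + f, hA, hB, hAl, hBl, ?_, ?_⟩
  · rw [leaves, List.length_append]
    omega
  · calc _ ≤ 36 * (6 ^ e * _) := Nat.mul_le_mul_left _ h₁
      _ = 6 ^ e * (36 * _) := by ring
      _ ≤ 6 ^ e * (6 ^ f * _) := Nat.mul_le_mul_left _ h₂
      _ = _ := by ring

theorem isModeled (N : ℕ) : ∀ t : BTree, (∀ c ∈ t.leaves, c ≤ N) → IsModeled N t
  | leaf c, hN => fun Φ _ => by
    refine ⟨0, by norm_num, [c], 0, ⟨List.pairwise_singleton _ _, by simpa [leaves] using hN⟩,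
      rfl, rfl, le_of_eq ?_⟩
    simp [ends, relabel, model, models, val]
    ring
  | node l r, hN => fun Φ hΦ => by
    obtain ⟨i, hi, j, hj, A, B, e, hA, hB, hAl, hBl, hlen, h₁⟩ :=
      (isModeled N l fun c hc => hN c (List.mem_append_left _ hc)).exists_prod
        (isModeled N r fun c hc => hN c (List.mem_append_right _ hc)) hΦ
    obtain ⟨d, s, hs, -, -, -, h₂⟩ := prod_models_le hi hj hA hB hAl hBl
    obtain ⟨g, hg, C, hC, hCl, rfl, h₃⟩ := h₂ Φ hΦ
    refine ⟨g, hg, C, e + d, hC, hCl, by omega, ?_⟩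
    refine Nat.le_of_mul_le_mul_left (c := 36) ?_ (by norm_num)
    calc _ ≤ _ := h₁
      _ ≤ 6 ^ e * _ := Nat.mul_le_mul_left _ h₃
      _ = _ := by ring

theorem total_ends_le (l r : BTree) : ∃ e s, (node l r).leaves.length = 4 * e + s ∧ 1 ≤ s ∧
    s ≤ 4 ∧ 36 * total (fun _ _ => 1) (node l r).ends ≤ 6 ^ e * maxTotal s := by
  have hN : ∀ c ∈ (node l r).leaves, c ≤ (node l r).leaves.sum :=
    fun c hc => List.single_le_sum (by simp) c hc
  obtain ⟨i, hi, j, hj, A, B, e, hA, hB, hAl, hBl, hlen, h₁⟩ :=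
    (isModeled _ l fun c hc => hN c (List.mem_append_left _ hc)).exists_prod
      (isModeled _ r fun c hc => hN c (List.mem_append_right _ hc)) .one
  obtain ⟨d, s, hs, hs₁, hs₄, h₂, -⟩ := prod_models_le hi hj hA hB hAl hBl
  refine ⟨e + d, s, by omega, hs₁, hs₄, ?_⟩
  refine Nat.le_of_mul_le_mul_left (c := 36) ?_ (by norm_num)
  calc _ ≤ _ := h₁
    _ ≤ 6 ^ e * _ := Nat.mul_le_mul_left _ h₂
    _ = _ := by ring

/-- Alternating words whose first letter is a peak if `s` is `true`, and a valley otherwise. -/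
def Zig : Bool → List ℕ → Prop
  | s, a :: b :: l => joins (s, a) (!s, b) = true ∧ Zig (!s) (b :: l)
  | _, _ => True

/-- The last end of a word which starts with a peak if `s` is `true`. -/
def lastEnd : Bool → List ℕ → WordEnd
  | s, [] => (s, 0)
  | s, [a] => (s, a)
  | s, _ :: b :: l => lastEnd (!s) (b :: l)

theorem exists_zig_of_isAlternating : ∀ {w : List ℕ}, IsAlternating w → ∃ s, Zig s w
  | [], _ => ⟨true, trivial⟩
  | [_], _ => ⟨true, trivial⟩
  | [a, b], h => by
    have := h.1 0 (by simp)
    simp only [List.getD_cons_zero, List.getD_cons_succ, zero_add] at this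
    rcases lt_or_gt_of_ne this with h | h
    · exact ⟨false, by simp [joins_false_iff, h], trivial⟩
    · exact ⟨true, by simp [joins_true_iff, h], trivial⟩
  | a :: b :: c :: l, h => by
    obtain ⟨s, hs⟩ := exists_zig_of_isAlternating (w := b :: c :: l)
      ⟨fun i hi => h.1 (i + 1) (by simpa using hi), fun i hi => h.2 (i + 1) (by simpa using hi)⟩
    refine ⟨!s, ?_, by simpa using hs⟩
    have h₁ := h.1 0 (by simp)
    have h₂ := h.2 0 (by simp)
    have h₃ := hs.1
    simp only [List.getD_cons_zero, List.getD_cons_succ, zero_add] at h₁ h₂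
    cases s <;> simp [joins_true_iff, joins_false_iff] at h₃ ⊢ <;> omega

theorem Zig.isAlternating : ∀ {s : Bool} {w : List ℕ}, Zig s w → IsAlternating w
  | _, [], _ => by constructor <;> simp
  | _, [_], _ => by constructor <;> simp
  | s, [a, b], h => by
    have := h.1
    refine ⟨fun i hi => ?_, fun i hi => by simp at hi⟩
    obtain rfl : i = 0 := by simpa using hi
    cases s <;> simp [joins_true_iff, joins_false_iff] at this ⊢ <;> omega
  | s, a :: b :: c :: l, h => by
    have ih := Zig.isAlternating h.2
    have h₁ := h.1
    have h₂ := h.2.1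
    constructor
    · rintro (_ | i) hi
      · cases s <;> simp [joins_true_iff, joins_false_iff] at h₁ ⊢ <;> omega
      · exact ih.1 i (by simpa using hi)
    · rintro (_ | i) hi
      · cases s <;> simp [joins_true_iff, joins_false_iff] at h₁ h₂ ⊢ <;> omega
      · exact ih.2 i (by simpa using hi)

theorem zig_append : ∀ {s : Bool} {u : List ℕ} {b : ℕ} {v : List ℕ}, u ≠ [] →
    (Zig s (u ++ b :: v) ↔ Zig s u ∧ Zig (!(lastEnd s u).1) (b :: v) ∧
      joins (lastEnd s u) (!(lastEnd s u).1, b) = true)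
  | s, [a], b, v, _ => by
    simp [Zig, lastEnd, and_comm]
  | s, a :: c :: u, b, v, _ => by
    have := zig_append (s := !s) (u := c :: u) (b := b) (v := v) (by simp)
    simp only [List.cons_append] at this
    simp only [List.cons_append, Zig, this, lastEnd, and_assoc]

theorem lastEnd_append : ∀ {s : Bool} {u : List ℕ} {b : ℕ} {v : List ℕ}, u ≠ [] →
    lastEnd s (u ++ b :: v) = lastEnd (!(lastEnd s u).1) (b :: v)
  | s, [a], b, v, _ => rfl
  | s, a :: c :: u, b, v, _ => lastEnd_append (s := !s) (u := c :: u) (by simp)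

/-- The alternating words of a tree, along with their ends. -/
def zigs : BTree → List (List ℕ × WordEnd × WordEnd)
  | leaf c => [([c], (true, c), (true, c)), ([c], (false, c), (false, c))]
  | node l r => l.zigs.flatMap fun x => r.zigs.flatMap fun y =>
    (bif joins x.2.2 y.2.1 then [(x.1 ++ y.1, x.2.1, y.2.2)] else []) ++
    (bif joins y.2.2 x.2.1 then [(y.1 ++ x.1, y.2.1, x.2.2)] else [])

theorem ends_eq_map_zigs : ∀ t : BTree, t.ends = t.zigs.map fun x => (1, x.2)
  | leaf c => rfl
  | node l r => by
    rw [ends, prod, ends_eq_map_zigs l, ends_eq_map_zigs r, zigs]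
    simp only [List.flatMap_map, List.map_flatMap, List.map_append]
    congr! 6 with x y
    · cases joins x.2.2 y.2.1 <;> rfl
    · cases joins y.2.2 x.2.1 <;> rfl

theorem total_one_ends (t : BTree) :
    total (fun _ _ => 1) t.ends = (t.zigs.map fun x => x.1).length := by
  rw [ends_eq_map_zigs]
  simp [total, Function.comp_def]

theorem ne_nil_of_mem_words : ∀ {t : BTree} {w : List ℕ}, w ∈ t.words → w ≠ []
  | leaf _, w, h => by
    obtain rfl := Finset.mem_singleton.1 h
    simp
  | node l r, w, h => by
    simp only [words, Finset.mem_union, Finset.mem_image, Finset.mem_product] at h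
    rcases h with ⟨p, hp, rfl⟩ | ⟨p, hp, rfl⟩
    · exact List.append_ne_nil_of_left_ne_nil (ne_nil_of_mem_words hp.1) _
    · exact List.append_ne_nil_of_right_ne_nil _ (ne_nil_of_mem_words hp.1)

theorem mem_zigs : ∀ {t : BTree} {s : Bool} {w : List ℕ}, w ∈ t.words → Zig s w →
    (w, (s, w.headI), lastEnd s w) ∈ t.zigs
  | leaf c, s, w, h, _ => by
    obtain rfl := Finset.mem_singleton.1 h
    cases s <;> simp [zigs, lastEnd]
  | node l r, s, w, h, hs => by
    simp only [words, Finset.mem_union, Finset.mem_image, Finset.mem_product] at h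
    simp only [zigs, List.mem_flatMap, List.mem_append]
    rcases h with ⟨⟨a, b⟩, ⟨ha, hb⟩, rfl⟩ | ⟨⟨b, a⟩, ⟨hb, ha⟩, rfl⟩ <;> dsimp only at hs ⊢ <;>
      obtain ⟨x, a', rfl⟩ := List.exists_cons_of_ne_nil (ne_nil_of_mem_words ha) <;>
      obtain ⟨y, b', rfl⟩ := List.exists_cons_of_ne_nil (ne_nil_of_mem_words hb) <;>
      rw [zig_append (by simp)] at hs <;> obtain ⟨h₁, h₂, h₃⟩ := hs <;>
      have hx := mem_zigs ha h₁ <;> have hy := mem_zigs hb h₂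
    · refine ⟨_, hx, _, hy, .inl ?_⟩
      simp [List.headI, h₃]
      exact lastEnd_append (u := x :: a') (by simp)
    · refine ⟨_, hy, _, hx, .inr ?_⟩
      simp [List.headI, h₃]
      exact lastEnd_append (u := x :: a') (by simp)

theorem altCount_le_total (t : BTree) : altCount t ≤ total (fun _ _ => 1) t.ends := by
  rw [total_one_ends]
  refine le_trans (Finset.card_le_card fun w hw => ?_) (List.toFinset_card_le _)
  obtain ⟨hw, ha⟩ := Finset.mem_filter.1 hw
  obtain ⟨s, hs⟩ := exists_zig_of_isAlternating ha
  exact List.mem_toFinset.2 (List.mem_map.2 ⟨_, mem_zigs hw hs, rfl⟩)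

theorem length_of_mem_words : ∀ {t : BTree} {w : List ℕ}, w ∈ t.words →
    w.length = t.leaves.length
  | leaf _, w, h => by
    obtain rfl := Finset.mem_singleton.1 h
    rfl
  | node l r, w, h => by
    simp only [words, Finset.mem_union, Finset.mem_image, Finset.mem_product] at h
    rw [leaves, List.length_append]
    rcases h with ⟨p, hp, rfl⟩ | ⟨p, hp, rfl⟩ <;>
      rw [List.length_append, length_of_mem_words hp.1, length_of_mem_words hp.2]
    exact add_comm _ _

theorem mem_leaves_of_mem_words : ∀ {t : BTree} {w : List ℕ}, w ∈ t.words →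
    ∀ {a}, a ∈ w → a ∈ t.leaves
  | leaf _, w, h, a, ha => by
    obtain rfl := Finset.mem_singleton.1 h
    exact ha
  | node l r, w, h, a, ha => by
    simp only [words, Finset.mem_union, Finset.mem_image, Finset.mem_product] at h
    rw [leaves, List.mem_append]
    rcases h with ⟨p, hp, rfl⟩ | ⟨p, hp, rfl⟩ <;> rcases List.mem_append.1 ha with ha | ha
    · exact .inl (mem_leaves_of_mem_words hp.1 ha)
    · exact .inr (mem_leaves_of_mem_words hp.2 ha)
    · exact .inr (mem_leaves_of_mem_words hp.2 ha)
    · exact .inl (mem_leaves_of_mem_words hp.1 ha)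

theorem kind_of_joins {e f : WordEnd} (h : joins e f = true) : f = (!e.1, f.2) := by
  obtain ⟨s, a⟩ := e
  obtain ⟨t, b⟩ := f
  cases s <;> cases t <;> simp [joins] at h ⊢

theorem mem_cond_singleton {α : Type*} {b : Bool} {a c : α} :
    a ∈ (bif b then [c] else []) ↔ b = true ∧ a = c := by
  cases b <;> simp

theorem of_mem_zigs : ∀ {t : BTree} {x : List ℕ × WordEnd × WordEnd}, x ∈ t.zigs →
    x.1 ∈ t.words ∧ Zig x.2.1.1 x.1 ∧ x.2 = ((x.2.1.1, x.1.headI), lastEnd x.2.1.1 x.1)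
  | leaf c, x, h => by
    simp only [zigs, List.mem_cons, List.not_mem_nil, or_false] at h
    rcases h with rfl | rfl <;> exact ⟨Finset.mem_singleton_self _, trivial, rfl⟩
  | node l r, z, h => by
    simp only [zigs, List.mem_flatMap, List.mem_append, mem_cond_singleton] at h
    have key : ∀ {t t' : BTree} {x y : List ℕ × WordEnd × WordEnd},
        (x.1 ∈ t.words ∧ Zig x.2.1.1 x.1 ∧ x.2 = ((x.2.1.1, x.1.headI), lastEnd x.2.1.1 x.1)) →
        (y.1 ∈ t'.words ∧ Zig y.2.1.1 y.1 ∧ y.2 = ((y.2.1.1, y.1.headI), lastEnd y.2.1.1 y.1)) →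
        joins x.2.2 y.2.1 = true → Zig x.2.1.1 (x.1 ++ y.1) ∧
          (x.2.1, y.2.2) = ((x.2.1.1, (x.1 ++ y.1).headI), lastEnd x.2.1.1 (x.1 ++ y.1)) := by
      rintro t t' ⟨u, e, f⟩ ⟨v, e', f'⟩ ⟨hu, hzu, hx⟩ ⟨hv, hzv, hy⟩ h
      dsimp only at *
      obtain ⟨a, u, rfl⟩ := List.exists_cons_of_ne_nil (ne_nil_of_mem_words hu)
      obtain ⟨b, v, rfl⟩ := List.exists_cons_of_ne_nil (ne_nil_of_mem_words hv)
      obtain ⟨he, hf⟩ := Prod.ext_iff.1 hx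
      obtain ⟨he', hf'⟩ := Prod.ext_iff.1 hy
      dsimp only [List.headI] at he hf he' hf'
      have hk := kind_of_joins h
      have hs : e'.1 = !(lastEnd e.1 (a :: u)).1 := by rw [← hf, hk]
      rw [hs] at hzv hf' he'
      rw [hf, he'] at h
      refine ⟨(zig_append (by simp)).2 ⟨hzu, hzv, h⟩, Prod.ext he ?_⟩
      rw [lastEnd_append (by simp)]
      exact hf'
    obtain ⟨x, hx, y, hy, h⟩ := h
    have hx' := of_mem_zigs hx
    have hy' := of_mem_zigs hy
    rcases h with ⟨hj, rfl⟩ | ⟨hj, rfl⟩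
    · exact ⟨Finset.mem_union_left _ (Finset.mem_image.2
        ⟨(x.1, y.1), Finset.mem_product.2 ⟨hx'.1, hy'.1⟩, rfl⟩), key hx' hy' hj⟩
    · exact ⟨Finset.mem_union_right _ (Finset.mem_image.2
        ⟨(x.1, y.1), Finset.mem_product.2 ⟨hx'.1, hy'.1⟩, rfl⟩), key hy' hx' hj⟩

theorem eq_of_mem_zigs {t : BTree} {x y : List ℕ × WordEnd × WordEnd} (hx : x ∈ t.zigs)
    (hy : y ∈ t.zigs) (h : x.1 = y.1) (hs : x.2.1.1 = y.2.1.1) : x = y := by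
  refine Prod.ext h ?_
  rw [(of_mem_zigs hx).2.2, (of_mem_zigs hy).2.2, h, hs]

theorem nodup_zigs : ∀ {t : BTree}, t.leaves.Nodup → t.zigs.Nodup
  | leaf c, _ => by simp [zigs]
  | node l r, h => by
    obtain ⟨hl, hr, hlr⟩ := List.nodup_append'.1 h
    have ne_swap : ∀ {u v u' v' : List ℕ}, u ∈ l.words → v ∈ r.words → u' ∈ l.words →
        v' ∈ r.words → u ++ v ≠ v' ++ u' := by
      intro u v u' v' hu hv hu' hv' heq
      obtain ⟨a, u, rfl⟩ := List.exists_cons_of_ne_nil (ne_nil_of_mem_words hu)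
      obtain ⟨b, v', rfl⟩ := List.exists_cons_of_ne_nil (ne_nil_of_mem_words hv')
      obtain rfl : a = b := (List.cons.inj heq).1
      exact hlr (mem_leaves_of_mem_words hu List.mem_cons_self)
        (mem_leaves_of_mem_words hv' List.mem_cons_self)
    have key : ∀ {x x' y y' z : List ℕ × WordEnd × WordEnd}, x ∈ l.zigs → x' ∈ l.zigs →
        y ∈ r.zigs → y' ∈ r.zigs →
        z ∈ (bif joins x.2.2 y.2.1 then [(x.1 ++ y.1, x.2.1, y.2.2)] else []) ++
          (bif joins y.2.2 x.2.1 then [(y.1 ++ x.1, y.2.1, x.2.2)] else []) →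
        z ∈ (bif joins x'.2.2 y'.2.1 then [(x'.1 ++ y'.1, x'.2.1, y'.2.2)] else []) ++
          (bif joins y'.2.2 x'.2.1 then [(y'.1 ++ x'.1, y'.2.1, x'.2.2)] else []) →
        x = x' ∧ y = y' := by
      intro x x' y y' z hx hx' hy hy' hz hz'
      have wx := (of_mem_zigs hx).1
      have wx' := (of_mem_zigs hx').1
      have wy := (of_mem_zigs hy).1
      have wy' := (of_mem_zigs hy').1
      rw [List.mem_append, mem_cond_singleton, mem_cond_singleton] at hz hz'
      rcases hz with ⟨hj, rfl⟩ | ⟨hj, rfl⟩ <;> rcases hz' with ⟨hj', h⟩ | ⟨hj', h⟩ <;>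
        obtain ⟨h₁, h₂⟩ := Prod.ext_iff.1 h <;> obtain ⟨h₂, -⟩ := Prod.ext_iff.1 h₂ <;>
        dsimp only at h₁ h₂
      · obtain ⟨h₃, h₄⟩ := List.append_inj h₁
          (by rw [length_of_mem_words wx, length_of_mem_words wx'])
        obtain rfl := eq_of_mem_zigs hx hx' h₃ (by rw [h₂])
        exact ⟨rfl, eq_of_mem_zigs hy hy' h₄ (by rw [kind_of_joins hj, kind_of_joins hj'])⟩
      · exact absurd h₁ (ne_swap wx wy wx' wy')
      · exact absurd h₁.symm (ne_swap wx' wy' wx wy)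
      · obtain ⟨h₃, h₄⟩ := List.append_inj h₁
          (by rw [length_of_mem_words wy, length_of_mem_words wy'])
        obtain rfl := eq_of_mem_zigs hy hy' h₃ (by rw [h₂])
        exact ⟨eq_of_mem_zigs hx hx' h₄ (by rw [kind_of_joins hj, kind_of_joins hj']), rfl⟩
    refine List.nodup_flatMap.2 ⟨fun x hx => List.nodup_flatMap.2 ⟨fun y hy => ?_, ?_⟩, ?_⟩
    · have := ne_swap (of_mem_zigs hx).1 (of_mem_zigs hy).1 (of_mem_zigs hx).1 (of_mem_zigs hy).1
      cases joins x.2.2 y.2.1 <;> cases joins y.2.2 x.2.1 <;> simp [this]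
    · exact (nodup_zigs hr).imp_of_mem fun hy hy' hne z hz hz' => hne (key hx hx hy hy' hz hz').2
    · refine (nodup_zigs hl).imp_of_mem fun hx hx' hne z hz hz' => ?_
      obtain ⟨y, hy, hz⟩ := List.mem_flatMap.1 hz
      obtain ⟨y', hy', hz'⟩ := List.mem_flatMap.1 hz'
      exact hne (key hx hx' hy hy' hz hz').1

theorem total_le_altCount {t : BTree} (h : t.leaves.Nodup) (hlen : 2 ≤ t.leaves.length) :
    total (fun _ _ => 1) t.ends ≤ altCount t := by
  have hN : (t.zigs.map fun x => x.1).Nodup := by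
    refine List.Nodup.map_on (fun x hx y hy hxy => eq_of_mem_zigs hx hy hxy ?_) (nodup_zigs h)
    obtain ⟨hw, hzx, -⟩ := of_mem_zigs hx
    have hzy := (of_mem_zigs hy).2.1
    rw [← hxy] at hzy
    have := length_of_mem_words hw
    rcases hc : x.1 with _ | ⟨a, _ | ⟨b, w⟩⟩
    · simp [hc] at this; omega
    · simp [hc] at this; omega
    · rw [hc] at hzx hzy
      have h₁ := hzx.1
      have h₂ := hzy.1
      cases hs : x.2.1.1 <;> cases hs' : y.2.1.1 <;> simp [hs, hs', joins] at h₁ h₂ ⊢ <;> omega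
  rw [total_one_ends, ← List.toFinset_card_of_nodup hN]
  refine Finset.card_le_card fun w hw => ?_
  obtain ⟨x, hx, rfl⟩ := List.mem_map.1 (List.mem_toFinset.1 hw)
  exact Finset.mem_filter.2 ⟨(of_mem_zigs hx).1, (of_mem_zigs hx).2.1.isAlternating⟩

/-- The tree with its labels changed by `f`. -/
def mapLeaves (f : ℕ → ℕ) : BTree → BTree
  | leaf a => leaf (f a)
  | node l r => node (l.mapLeaves f) (r.mapLeaves f)

theorem leaves_mapLeaves (f : ℕ → ℕ) : ∀ t : BTree, (t.mapLeaves f).leaves = t.leaves.map f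
  | leaf _ => rfl
  | node l r => by
    rw [mapLeaves, leaves, leaves, leaves_mapLeaves f l, leaves_mapLeaves f r, List.map_append]

theorem total_one_ends_mapLeaves {f : ℕ → ℕ} (hf : StrictMono f) (t : BTree) :
    total (fun _ _ => 1) (t.mapLeaves f).ends = total (fun _ _ => 1) t.ends := by
  have h : ∀ t : BTree, (t.mapLeaves f).ends = relabel f t.ends := by
    have hj : ∀ e e' : WordEnd, joins (e.1, f e.2) (e'.1, f e'.2) = joins e e' := by
      rintro ⟨s, a⟩ ⟨s', b⟩
      cases s <;> simp [joins_true_iff, joins_false_iff, hf.lt_iff_lt]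
    intro t
    induction t with
    | leaf c => rfl
    | node l r hl hr =>
      rw [mapLeaves, ends, ends, hl, hr]
      simp only [prod, relabel, List.flatMap_map, List.map_flatMap, List.map_append, hj,
        Bool.apply_cond (List.map _), List.map_cons, List.map_nil]
  rw [h, total_relabel]

theorem of_mem_ends : ∀ {t : BTree} {x : ℕ × WordEnd × WordEnd}, x ∈ t.ends →
    (x.2.1.1 = x.2.2.1 ↔ Odd t.leaves.length) ∧ x.2.1.2 ∈ t.leaves ∧ x.2.2.2 ∈ t.leaves
  | leaf c, x, h => by
    simp only [ends, List.mem_cons, List.not_mem_nil, or_false] at h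
    rcases h with rfl | rfl <;> simp [leaves]
  | node l r, z, h => by
    simp only [ends, prod, List.mem_flatMap, List.mem_append, mem_cond_singleton] at h
    obtain ⟨x, hx, y, hy, h⟩ := h
    obtain ⟨h₁, h₂, h₃⟩ := of_mem_ends hx
    obtain ⟨h₄, h₅, h₆⟩ := of_mem_ends hy
    rw [leaves, List.length_append, Nat.odd_add, ← Nat.not_odd_iff_even, ← h₁, ← h₄]
    rcases h with ⟨hj, rfl⟩ | ⟨hj, rfl⟩
    · refine ⟨?_, List.mem_append_left _ h₂, List.mem_append_right _ h₆⟩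
      rw [kind_of_joins hj]
      cases x.2.1.1 <;> cases x.2.2.1 <;> cases y.2.2.1 <;> simp
    · refine ⟨?_, List.mem_append_right _ h₅, List.mem_append_left _ h₃⟩
      rw [kind_of_joins hj]
      cases x.2.2.1 <;> cases y.2.2.1 <;> cases y.2.1.1 <;> simp

theorem kinds_of_even {t : BTree} (ht : Even t.leaves.length) {x : ℕ × WordEnd × WordEnd}
    (hx : x ∈ t.ends) :
    ∃ i ∈ t.leaves, ∃ j ∈ t.leaves,
      x.2 = ((true, i), (false, j)) ∨ x.2 = ((false, i), (true, j)) := by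
  obtain ⟨h, hi, hj⟩ := of_mem_ends hx
  obtain ⟨w, ⟨s, i⟩, s', j⟩ := x
  refine ⟨i, hi, j, hj, ?_⟩
  have := mt h.1 (Nat.not_odd_iff_even.2 ht)
  cases s <;> cases s' <;> simp at this ⊢

theorem toNat_blt (a b : ℕ) : (Nat.blt a b).toNat = if a < b then 1 else 0 := by
  rcases h : Nat.blt a b <;> simp [← Nat.blt_eq, h]

theorem six_mul_total_le {t : BTree} (ht : Even t.leaves.length) {a b c d : ℕ}
    (ha : ∀ i ∈ t.leaves, a < i) (hb : ∀ i ∈ t.leaves, i < b) (hbc : b < c) (hcd : c < d) :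
    6 * total (fun _ _ => 1) t.ends ≤
      total (fun _ _ => 1) (node (node (node (node t (leaf a)) (leaf d)) (leaf b))
        (leaf c)).ends := by
  simp only [ends, total_prod]
  rw [← total_mul]
  refine total_mono fun x hx => ?_
  obtain ⟨i, hi, j, hj, h⟩ := kinds_of_even ht hx
  have h₁ := ha i hi
  have h₂ := ha j hj
  have h₃ := hb i hi
  have h₄ := hb j hj
  have h₅ : a < b := h₁.trans h₃
  have h₆ : a < c := h₅.trans hbc
  have h₇ : b < d := hbc.trans hcd
  rcases h with h | h <;> rw [h] <;>
    simp [joins, toNat_blt, Nat.lt_asymm, h₁, h₂, h₃, h₄, h₅, h₆, h₇, hbc, hcd,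
      h₆.trans hcd, h₃.trans hbc, h₄.trans hbc, h₃.trans h₇, h₄.trans h₇]

theorem four_mul_total_le {t : BTree} (ht : Even t.leaves.length) {a b c : ℕ}
    (ha : ∀ i ∈ t.leaves, a < i) (hb : ∀ i ∈ t.leaves, i < b) (hbc : b < c) :
    4 * total (fun _ _ => 1) t.ends ≤
      total (fun _ _ => 1) (node (node (node t (leaf a)) (leaf c)) (leaf b)).ends := by
  simp only [ends, total_prod]
  rw [← total_mul]
  refine total_mono fun x hx => ?_
  obtain ⟨i, hi, j, hj, h⟩ := kinds_of_even ht hx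
  have h₁ := ha i hi
  have h₂ := ha j hj
  have h₃ := hb i hi
  have h₄ := hb j hj
  have h₅ : a < b := h₁.trans h₃
  have h₆ : a < c := h₅.trans hbc
  rcases h with h | h <;> rw [h] <;>
    simp [joins, toNat_blt, Nat.lt_asymm, h₁, h₂, h₃, h₄, h₅, h₆, hbc, h₃.trans hbc, h₄.trans hbc]

/-- Some tree with leaves labeled by `1, …, n` has at least `m` alternating words. -/
def Attains (n m : ℕ) : Prop :=
  ∃ t : BTree, t.leaves.Perm (List.range' 1 n) ∧ m ≤ total (fun _ _ => 1) t.ends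

theorem Attains.exists_shift {n m : ℕ} (h : Attains n m) :
    ∃ t : BTree, t.leaves.Perm (List.range' 2 n) ∧ m ≤ total (fun _ _ => 1) t.ends := by
  obtain ⟨t, ht, hm⟩ := h
  refine ⟨t.mapLeaves (1 + ·), ?_, ?_⟩
  · rw [leaves_mapLeaves, show List.range' 2 n = (List.range' 1 n).map (1 + ·) from
      (List.map_add_range' (a := 1) 1 n 1).symm]
    exact ht.map _
  · rwa [total_one_ends_mapLeaves fun a b h => Nat.add_lt_add_left h 1]

theorem Attains.add_four {n m : ℕ} (h : Attains n m) (hn : Even n) : Attains (n + 4) (6 * m) := by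
  obtain ⟨t, ht, hm⟩ := h.exists_shift
  refine ⟨node (node (node (node t (leaf 1)) (leaf (n + 4))) (leaf (n + 2))) (leaf (n + 3)), ?_,
    (Nat.mul_le_mul_left 6 hm).trans (six_mul_total_le ?_ ?_ ?_ ?_ ?_)⟩
  · have h : List.range' 1 (n + 4) = 1 :: (List.range' 2 n ++ [n + 2, n + 3, n + 4]) := by
      rw [List.range'_succ, ← List.range'_append_1 (s := 1 + 1) (m := n) (n := 3)]
      simp [List.range'_succ]
      omega
    rw [h]
    simp only [leaves, List.append_assoc]
    refine (List.perm_middle.trans (List.Perm.cons 1 (ht.append ?_)))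
    exact (List.perm_append_comm (l₁ := [n + 4]) (l₂ := [n + 2, n + 3]))
  · simpa [ht.length_eq] using hn
  all_goals intros
  all_goals simp_all [ht.mem_iff, List.mem_range'_1]
  all_goals omega

theorem Attains.add_three {n m : ℕ} (h : Attains n m) (hn : Even n) : Attains (n + 3) (4 * m) := by
  obtain ⟨t, ht, hm⟩ := h.exists_shift
  refine ⟨node (node (node t (leaf 1)) (leaf (n + 3))) (leaf (n + 2)), ?_,
    (Nat.mul_le_mul_left 4 hm).trans (four_mul_total_le ?_ ?_ ?_ ?_)⟩
  · have h : List.range' 1 (n + 3) = 1 :: (List.range' 2 n ++ [n + 2, n + 3]) := by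
      rw [List.range'_succ, ← List.range'_append_1 (s := 1 + 1) (m := n) (n := 2)]
      simp [List.range'_succ]
      omega
    rw [h]
    simp only [leaves, List.append_assoc]
    refine (List.perm_middle.trans (List.Perm.cons 1 (ht.append ?_)))
    exact (List.perm_append_comm (l₁ := [n + 3]) (l₂ := [n + 2]))
  · simpa [ht.length_eq] using hn
  all_goals intros
  all_goals simp_all [ht.mem_iff, List.mem_range'_1]
  all_goals omega

theorem attains_four_mul_add_four (k : ℕ) : Attains (4 * k + 4) (6 * 6 ^ k) := by
  induction k with
  | zero =>
    exact ⟨node (node (node (leaf 4) (leaf 1)) (leaf 3)) (leaf 2), by decide, by decide⟩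
  | succ k ih =>
    rw [pow_succ']
    exact ih.add_four ⟨2 * k + 2, by ring⟩

theorem attains_four_mul_add_six (k : ℕ) : Attains (4 * k + 6) (14 * 6 ^ k) := by
  induction k with
  | zero =>
    exact ⟨node (node (node (leaf 6) (leaf 2)) (leaf 4)) (node (node (leaf 5) (leaf 1)) (leaf 3)),
      by decide, by decide⟩
  | succ k ih =>
    rw [pow_succ', mul_left_comm]
    exact ih.add_four ⟨2 * k + 3, by ring⟩

theorem altCount_le {n e s : ℕ} (hn : 2 ≤ n) (h : n = 4 * e + s) (hs : 1 ≤ s) (hs' : s ≤ 4)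
    {t : BTree} (ht : t.leaves.Perm (List.range' 1 n)) :
    36 * altCount t ≤ 6 ^ e * maxTotal s := by
  have hlen : t.leaves.length = n := by simpa using ht.length_eq
  cases t with
  | leaf c => simp [leaves] at hlen; omega
  | node l r =>
    obtain ⟨e', s', h', hs₁, hs₂, hle⟩ := total_ends_le l r
    obtain rfl : e' = e := by omega
    obtain rfl : s' = s := by omega
    exact (Nat.mul_le_mul_left 36 (altCount_le_total _)).trans hle

theorem rAlt_eq {n m e s : ℕ} (hn : 2 ≤ n) (h : n = 4 * e + s) (hs : 1 ≤ s) (hs' : s ≤ 4)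
    (hm : 36 * m = 6 ^ e * maxTotal s) (ha : Attains n m) : rAlt n = m := by
  have hle : ∀ t : BTree, t.leaves.Perm (List.range' 1 n) → altCount t ≤ m := fun t ht =>
    Nat.le_of_mul_le_mul_left ((altCount_le hn h hs hs' ht).trans hm.ge) (by norm_num)
  obtain ⟨t, ht, hmt⟩ := ha
  refine IsGreatest.csSup_eq ⟨⟨t, ht, ?_⟩, ?_⟩
  · refine le_antisymm (hmt.trans (total_le_altCount ?_ ?_)) (hle t ht)
    · exact ht.nodup_iff.2 List.nodup_range'
    · simpa [ht.length_eq] using hn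
  · rintro _ ⟨t, ht, rfl⟩
    exact hle t ht

theorem rAlt_four_mul_add_six (k : ℕ) : rAlt (4 * k + 6) = 14 * 6 ^ k :=
  rAlt_eq (e := k + 1) (s := 2) (by omega) (by ring) (by norm_num) (by norm_num)
    (by rw [maxTotal]; simp; ring) (attains_four_mul_add_six k)

theorem rAlt_four_mul_add_seven (k : ℕ) : rAlt (4 * k + 7) = 24 * 6 ^ k :=
  rAlt_eq (e := k + 1) (s := 3) (by omega) (by ring) (by norm_num) (by norm_num)
    (by rw [maxTotal]; simp; ring) (by
      rw [show 24 * 6 ^ k = 4 * (6 * 6 ^ k) by ring]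
      exact (attains_four_mul_add_four k).add_three ⟨2 * k + 2, by ring⟩)

theorem rAlt_four_mul_add_eight (k : ℕ) : rAlt (4 * k + 8) = 36 * 6 ^ k :=
  rAlt_eq (e := k + 1) (s := 4) (by omega) (by ring) (by norm_num) (by norm_num)
    (by rw [maxTotal]; simp; ring) (by
      rw [show 36 * 6 ^ k = 6 * 6 ^ (k + 1) by ring]
      exact attains_four_mul_add_four (k + 1))

theorem rAlt_four_mul_add_nine (k : ℕ) : rAlt (4 * k + 9) = 56 * 6 ^ k :=
  rAlt_eq (e := k + 2) (s := 1) (by omega) (by ring) (by norm_num) (by norm_num)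
    (by rw [maxTotal]; simp; ring) (by
      rw [show 56 * 6 ^ k = 4 * (14 * 6 ^ k) by ring]
      exact (attains_four_mul_add_six k).add_three ⟨2 * k + 3, by ring⟩)

end BTree

/-- For `n ≥ 6`, the scaling relation `r_{n+4} = 6 r_n`. -/
theorem rAlt_scaling : ∀ n : ℕ, 6 ≤ n → rAlt (n + 4) = 6 * rAlt n := by
  intro n hn
  obtain ⟨k, rfl | rfl | rfl | rfl⟩ :
      ∃ k, n = 4 * k + 6 ∨ n = 4 * k + 7 ∨ n = 4 * k + 8 ∨ n = 4 * k + 9 :=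
    ⟨(n - 6) / 4, by omega⟩
  · have := BTree.rAlt_four_mul_add_six (k + 1)
    rw [BTree.rAlt_four_mul_add_six, show 4 * k + 6 + 4 = 4 * (k + 1) + 6 by ring, this]
    ring
  · have := BTree.rAlt_four_mul_add_seven (k + 1)
    rw [BTree.rAlt_four_mul_add_seven, show 4 * k + 7 + 4 = 4 * (k + 1) + 7 by ring, this]
    ring
  · have := BTree.rAlt_four_mul_add_eight (k + 1)
    rw [BTree.rAlt_four_mul_add_eight, show 4 * k + 8 + 4 = 4 * (k + 1) + 8 by ring, this]
    ring
  · have := BTree.rAlt_four_mul_add_nine (k + 1)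
    rw [BTree.rAlt_four_mul_add_nine, show 4 * k + 9 + 4 = 4 * (k + 1) + 9 by ring, this]
    ring
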